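/- arXiv:2312.10554 — 2 statements merged into one kernel-verified Lean document; each statement's English description precedes it below -/
import Mathlib

section
/- Let n, m be coprime integers, not both zero, and let k, k' ∈ ℝ × ℝ be knots (both coordinates in {j/2 : j ∈ ℤ}) satisfying m*k'.1 − n*k'.2 = m*k.1 − n*k.2 + 1/2. Then the four points k, k + (n/2, m/2), k', k' + (n/2, m/2) are pairwise incongruent modulo ℤ × ℤ: the difference of any two of them is not an integer vector. (Hence the vertices of the fundamental parallelogram spanning a knot-free strip of direction (n, m) represent four distinct vertices of the disphenoid.) -/
/-- A real number is a half-integer if it equals `j/2` for some integer `j`. -/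
def IsHalfInt (x : ℝ) : Prop := ∃ j : ℤ, x = j / 2

/-- A point of `ℝ²` is a knot of the full net of the disphenoid if both of its
coordinates are half-integers. -/
def IsKnot (p : ℝ × ℝ) : Prop := IsHalfInt p.1 ∧ IsHalfInt p.2

/-- Half of a primitive integer vector is not an integer vector. -/
theorem IsCoprime.half_not_integer_vector {n m : ℤ} (hco : IsCoprime n m) (a b : ℤ)
    (ha : (n : ℝ) / 2 = a) (hb : (m : ℝ) / 2 = b) : False := by
  have hn : n = 2 * a := by
    have : (n : ℝ) = 2 * a := by linarith
    exact_mod_cast this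
  have hm : m = 2 * b := by
    have : (m : ℝ) = 2 * b := by linarith
    exact_mod_cast this
  have h2 : IsUnit (2 : ℤ) := hco.isUnit_of_dvd' ⟨a, hn⟩ ⟨b, hm⟩
  exact absurd (Int.isUnit_iff.mp h2) (by decide)

/-- An integer is not equal to one half. -/
theorem Int.cast_ne_one_half (c : ℤ) : (c : ℝ) ≠ 1 / 2 := by
  intro h
  have h2 : (2 * c : ℝ) = 1 := by linarith
  have : 2 * c = 1 := by exact_mod_cast h2
  omega

/-- If `k, k'` are knots with `m k'.1 - n k'.2 = m k.1 - n k.2 + 1/2` (i.e. they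
lie on the two boundary lines of a fundamental knot-free strip of direction
`(n, m)`), then the four knots `k`, `k + (n/2, m/2)`, `k'`, `k' + (n/2, m/2)`
are pairwise incongruent modulo `ℤ²`: they represent the four distinct vertices
of the disphenoid. -/
theorem strip_parallelogram_vertices_distinct
    (n m : ℤ) (hco : IsCoprime n m) (hnz : ¬ (n = 0 ∧ m = 0))
    (k k' : ℝ × ℝ) (hk : IsKnot k) (hk' : IsKnot k')
    (hrel : (m : ℝ) * k'.1 - (n : ℝ) * k'.2 = (m : ℝ) * k.1 - (n : ℝ) * k.2 + 1 / 2) :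
    ∀ i j : Fin 4, i ≠ j →
      ¬ ∃ u : ℤ × ℤ,
        ![k, k + ((n : ℝ) / 2, (m : ℝ) / 2), k', k' + ((n : ℝ) / 2, (m : ℝ) / 2)] i -
          ![k, k + ((n : ℝ) / 2, (m : ℝ) / 2), k', k' + ((n : ℝ) / 2, (m : ℝ) / 2)] j =
          ((u.1 : ℝ), (u.2 : ℝ)) := by
  rintro i j hij ⟨⟨a, b⟩, h⟩
  obtain ⟨h₁, h₂⟩ := Prod.ext_iff.mp h
  fin_cases i <;> fin_cases j <;> simp at hij h₁ h₂ <;>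
  first
  | exact hco.half_not_integer_vector a b (by linarith) (by linarith)
  | exact hco.half_not_integer_vector (-a) (-b)
      (by push_cast; linarith) (by push_cast; linarith)
  | exact Int.cast_ne_one_half (m * a - n * b)
      (by push_cast; rw [← h₁, ← h₂]; linear_combination hrel)
  | exact Int.cast_ne_one_half (n * b - m * a)
      (by push_cast; rw [← h₁, ← h₂]; linear_combination hrel)
end

section
/- Let A, B, C ∈ E = EuclideanSpace ℝ (Fin 3) form an equilateral triangle (dist A B = dist B C = dist C A = a > 0) and let V ∈ E be such that A, B, C, V are affinely independent and dist V A = dist V B = dist V C = b with b ≠ a (a right triangular pyramid that is not a regular tetrahedron). Then there exists no simple closed geodesic in frontier (convexHull ℝ {A, B, C, V}). -/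
/-- A simple closed geodesic in a closed set `F ⊆ EuclideanSpace ℝ (Fin 3)`:
a continuous map `γ : ℝ → E`, periodic with period 1, injective on `[0,1)`,
with image in `F`, of finite positive length (total variation on `[0,1]`),
that is locally shortest among continuous paths in `F`. -/
def IsSimpleClosedGeodesicIn (F : Set (EuclideanSpace ℝ (Fin 3)))
    (γ : ℝ → EuclideanSpace ℝ (Fin 3)) : Prop :=
  Continuous γ ∧
  Function.Periodic γ 1 ∧
  Set.InjOn γ (Set.Ico (0 : ℝ) 1) ∧
  (∀ t : ℝ, γ t ∈ F) ∧
  0 < eVariationOn γ (Set.Icc 0 1) ∧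
  eVariationOn γ (Set.Icc 0 1) < ⊤ ∧
  ∀ t : ℝ, ∃ ε > (0 : ℝ), ∀ s₁ s₂ : ℝ,
    s₁ ∈ Set.Ioo (t - ε) (t + ε) → s₂ ∈ Set.Ioo (t - ε) (t + ε) → s₁ ≤ s₂ →
    ∀ (a b : ℝ) (c : ℝ → EuclideanSpace ℝ (Fin 3)), a ≤ b →
      ContinuousOn c (Set.Icc a b) → c a = γ s₁ → c b = γ s₂ →
      (∀ x ∈ Set.Icc a b, c x ∈ F) →
      eVariationOn γ (Set.Icc s₁ s₂) ≤ eVariationOn c (Set.Icc a b)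

namespace TetraGeodesic

set_option linter.unusedSectionVars false

/-- The element of `Fin 4` distinct from three given distinct ones. -/
def fourth (p q r : Fin 4) : Fin 4 := 2 - (p + q + r)

/-- The sign of the permutation `(x, y, q, p)` of `Fin 4`, where `y` is the remaining element. -/
def cornerSign (x p q : Fin 4) : ℤ :=
  let y := fourth x p q
  let d : Fin 4 → Fin 4 → ℤ := fun u v => (v.val : ℤ) - u.val
  (d x y * d x q * d x p * d y q * d y p * d q p).sign

lemma fourth_ne : ∀ p q r : Fin 4, p ≠ q → p ≠ r → q ≠ r →
    fourth p q r ≠ p ∧ fourth p q r ≠ q ∧ fourth p q r ≠ r := by decide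

set_option synthInstance.maxHeartbeats 400000 in
set_option synthInstance.maxSize 1000 in
lemma cornerSign_other : ∀ x y p q : Fin 4, x ≠ y → x ≠ p → x ≠ q → y ≠ p → y ≠ q → p ≠ q →
    cornerSign y p q = - cornerSign x p q := by decide

set_option synthInstance.maxHeartbeats 400000 in
set_option synthInstance.maxSize 1000 in
lemma cornerSign_rotate : ∀ x p q r : Fin 4, x ≠ p → x ≠ q → x ≠ r → p ≠ q → p ≠ r → q ≠ r →
    cornerSign x q r = cornerSign x p q := by decide

lemma cornerSign_eq_one_or : ∀ x p q : Fin 4, x ≠ p → x ≠ q → p ≠ q →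
    cornerSign x p q = 1 ∨ cornerSign x p q = -1 := by decide

section Rank

variable {ι : Type*} [DecidableEq ι]

lemma rank_injOn (s : Finset ι) (d : ι → ℝ) (hd : Set.InjOn d s) :
    Set.InjOn (fun i => (s.filter fun j => d i < d j).card) s := by
  have key : ∀ i ∈ s, ∀ j ∈ s, d i < d j →
      (s.filter fun k => d j < d k).card < (s.filter fun k => d i < d k).card := by
    intro i hi j hj hij
    apply Finset.card_lt_card
    refine ⟨fun k hk => ?_, fun h => ?_⟩
    · simp only [Finset.mem_filter] at hk ⊢
      exact ⟨hk.1, hij.trans hk.2⟩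
    · have := h (Finset.mem_filter.2 ⟨hj, hij⟩)
      simp at this
  intro i hi j hj hij
  simp only at hij
  by_contra hne
  rcases lt_trichotomy (d i) (d j) with h | h | h
  · exact absurd hij (key i hi j hj h).ne'
  · exact hne (hd hi hj h)
  · exact absurd hij (key j hj i hi h).ne

lemma rank_lt_card (s : Finset ι) (d : ι → ℝ) {i : ι} (hi : i ∈ s) :
    (s.filter fun j => d i < d j).card < s.card := by
  apply Finset.card_lt_card
  refine ⟨Finset.filter_subset _ _, fun h => ?_⟩
  have := h hi
  simp at this

lemma image_rank (s : Finset ι) (d : ι → ℝ) (hd : Set.InjOn d s) :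
    s.image (fun i => (s.filter fun j => d i < d j).card) = Finset.range s.card := by
  apply Finset.eq_of_subset_of_card_le
  · intro r hr
    obtain ⟨i, hi, rfl⟩ := Finset.mem_image.1 hr
    exact Finset.mem_range.2 (rank_lt_card s d hi)
  · rw [Finset.card_image_of_injOn (rank_injOn s d hd), Finset.card_range]

lemma sum_neg_one_pow_rank (s : Finset ι) (d : ι → ℝ) (hd : Set.InjOn d s) :
    ∑ i ∈ s, (-1 : ℝ) ^ (s.filter fun j => d i < d j).card = if Odd s.card then 1 else 0 := by
  have h := Finset.sum_image (f := fun r => (-1 : ℝ) ^ r) (rank_injOn s d hd)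
  rw [image_rank s d hd] at h
  rw [← h]
  rw [neg_one_geom_sum]
  by_cases ho : Odd s.card
  · simp [ho, Nat.not_even_iff_odd.2 ho]
  · simp [ho, Nat.not_odd_iff_even.1 ho]

end Rank

/-- Combinatorial data of a closed curve crossing the edges of a tetrahedron. Arc `i` runs from
crossing `i` to crossing `i + 1` inside the face opposite to the vertex `f i`, and `c i` are the
barycentric coordinates of crossing `i`. The last condition says that arcs do not cross. -/
structure ArcSystem (n : ℕ) (f : ZMod n → Fin 4) (c : ZMod n → Fin 4 → ℝ) : Prop where
  ne_succ : ∀ i, f (i - 1) ≠ f i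
  ne_succ' : ∀ i, f i ≠ f (i + 1)
  ne_two : ∀ i, f (i - 1) ≠ f (i + 1)
  inj : ∀ i j y z, i ≠ j → y ≠ f (i - 1) → y ≠ f i → z ≠ f (i - 1) → z ≠ f i → y ≠ z →
    ((f (j - 1) = f (i - 1) ∧ f j = f i) ∨ (f (j - 1) = f i ∧ f j = f (i - 1))) →
    c i y ≠ c j y ∧ (c i y < c j y ↔ c j z < c i z)
  noncross : ∀ a b x, a ≠ b → f a = f b → x = fourth (f (a - 1)) (f a) (f (a + 1)) →
    ∀ s t : Bool, cond s (f (a + 1)) (f (a - 1)) = cond t (f (b + 1)) (f (b - 1)) →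
      c (cond s (a + 1) a) x < c (cond t (b + 1) b) x →
      cond s (f (a - 1)) (f (a + 1)) = cond t (f (b - 1)) (f (b + 1)) ∧
      c (cond s a (a + 1)) x < c (cond t b (b + 1)) x

namespace ArcSystem

variable {n : ℕ} [NeZero n] {f : ZMod n → Fin 4} {c : ZMod n → Fin 4 → ℝ}

/-- The vertex cut off by an arc. -/
def corner (f : ZMod n → Fin 4) (a : ZMod n) : Fin 4 := fourth (f (a - 1)) (f a) (f (a + 1))

/-- Crossing `j` lies on the edge common to the faces opposite to `v` and `w`. -/
def OnEdge (f : ZMod n → Fin 4) (v w : Fin 4) (j : ZMod n) : Prop :=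
  (f (j - 1) = v ∧ f j = w) ∨ (f (j - 1) = w ∧ f j = v)

instance (f : ZMod n → Fin 4) (v w : Fin 4) : DecidablePred (OnEdge f v w) := fun j => by
  unfold OnEdge; infer_instance

lemma OnEdge.symm {v w : Fin 4} {j : ZMod n} (h : OnEdge f v w j) : OnEdge f w v j := Or.symm h

lemma onEdge_self (i : ZMod n) : OnEdge f (f (i - 1)) (f i) i := Or.inl ⟨rfl, rfl⟩

/-- The crossings on an edge. -/
def edge (f : ZMod n → Fin 4) (v w : Fin 4) : Finset (ZMod n) := {j | OnEdge f v w j}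

/-- The arcs in the face opposite to `w` cutting off `x`. -/
def arcs (f : ZMod n → Fin 4) (x w : Fin 4) : Finset (ZMod n) := {a | f a = w ∧ corner f a = x}

/-- The number of crossings on the edge of crossing `i` which are nearer to the vertex `y`. -/
noncomputable def rank (f : ZMod n → Fin 4) (c : ZMod n → Fin 4 → ℝ) (y : Fin 4) (i : ZMod n) : ℕ :=
  ((edge f (f (i - 1)) (f i)).filter fun j => c i y < c j y).card

/-- A quantity ordering the arcs at a corner. -/
noncomputable def height (c : ZMod n → Fin 4 → ℝ) (x : Fin 4) (a : ZMod n) : ℝ := c a x + c (a + 1) x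

lemma mem_edge {v w : Fin 4} {j : ZMod n} : j ∈ edge f v w ↔ OnEdge f v w j := by
  simp [edge]

lemma mem_arcs {x w : Fin 4} {a : ZMod n} : a ∈ arcs f x w ↔ f a = w ∧ corner f a = x := by
  simp [arcs]

lemma edge_comm (v w : Fin 4) : edge f v w = edge f w v := by
  ext j; simp only [mem_edge, OnEdge]; tauto

lemma corner_ne (h : ArcSystem n f c) (a : ZMod n) :
    corner f a ≠ f (a - 1) ∧ corner f a ≠ f a ∧ corner f a ≠ f (a + 1) :=
  fourth_ne _ _ _ (h.ne_succ a) (h.ne_two a) (h.ne_succ' a)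

lemma card_edge_filter (h : ArcSystem n f c)
    {v w : Fin 4} (hvw : v ≠ w) (Q : ZMod n → Prop) [DecidablePred Q] :
    ((edge f v w).filter Q).card = (Finset.univ.filter fun b : ZMod n => f b = w ∧
      ((f (b - 1) = v ∧ Q b) ∨ (f (b + 1) = v ∧ Q (b + 1)))).card := by
  refine Finset.card_nbij' (fun j => if f j = w then j else j - 1)
    (fun b => if f (b - 1) = v then b else b + 1) ?_ ?_ ?_ ?_
  · intro j hj
    simp only [Finset.mem_coe, Finset.mem_filter, mem_edge, OnEdge, Finset.mem_univ,
      true_and] at hj ⊢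
    rcases hj with ⟨⟨h1, h2⟩ | ⟨h1, h2⟩, hq⟩
    · simp [h1, h2, hq]
    · simp [h1, h2, hvw, hq]
  · intro b hb
    simp only [Finset.mem_coe, Finset.mem_filter, mem_edge, OnEdge, Finset.mem_univ,
      true_and] at hb ⊢
    rcases hb with ⟨h1, ⟨h2, hq⟩ | ⟨h2, hq⟩⟩
    · simp [h1, h2, hq]
    · have : f (b - 1) ≠ v := fun h3 => h.ne_two b (h3.trans h2.symm)
      simp [h1, h2, hq, this]
  · intro j hj
    simp only [Finset.mem_coe, Finset.mem_filter, mem_edge, OnEdge] at hj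
    rcases hj with ⟨⟨h1, h2⟩ | ⟨h1, h2⟩, hq⟩
    · simp [h1, h2]
    · have : f (j - 1 - 1) ≠ v := by
        intro h3
        have := h.ne_two (j - 1)
        simp [h3, h2] at this
      simp [h2, hvw, this]
  · intro b hb
    simp only [Finset.mem_coe, Finset.mem_filter, Finset.mem_univ, true_and] at hb
    rcases hb with ⟨h1, ⟨h2, hq⟩ | ⟨h2, hq⟩⟩
    · simp [h1, h2]
    · have : f (b - 1) ≠ v := fun h3 => h.ne_two b (h3.trans h2.symm)
      simp [h2, this, hvw]

lemma fourth_unique (h : ArcSystem n f c)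
    (a b : ZMod n) (hf : f a = f b) (hx : corner f a = corner f b) :
    (f (b - 1) = f (a - 1) ∧ f (b + 1) = f (a + 1)) ∨
      (f (b - 1) = f (a + 1) ∧ f (b + 1) = f (a - 1)) := by
  have h1 := h.corner_ne a
  have h2 := h.corner_ne b
  rw [← hx] at h2
  have a1 := h.ne_succ a
  have a2 := h.ne_succ' a
  have a3 := h.ne_two a
  have b1 := h.ne_succ b
  have b2 := h.ne_succ' b
  have b3 := h.ne_two b
  rw [← hf] at b1 b2 h2
  generalize f (b - 1) = b0 at *
  generalize f (b + 1) = b0 at *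
  generalize f (a - 1) = b0 at *
  generalize f (a + 1) = b0 at *
  generalize corner f a = b0 at *
  generalize f a = b0 at *
  clear hf hx h
  omega

lemma height_lt (h : ArcSystem n f c) {a b : ZMod n} (hab : a ≠ b) (hf : f a = f b) (s t : Bool)
    (hz : cond s (f (a + 1)) (f (a - 1)) = cond t (f (b + 1)) (f (b - 1)))
    (hc : c (cond s (a + 1) a) (corner f a) < c (cond t (b + 1) b) (corner f a)) :
    corner f b = corner f a ∧ height c (corner f a) a < height c (corner f a) b := by
  have := h.noncross a b _ hab hf rfl s t hz hc
  have := this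
  unfold height
  constructor
  · unfold corner
    cases s <;> cases t <;> simp_all [fourth, add_assoc, add_comm, add_left_comm]
  · unfold corner at *
    cases s <;> cases t <;> simp only [cond] at * <;> linarith

lemma endpoint_ne (h : ArcSystem n f c) {a b : ZMod n} (hab : a ≠ b) (hf : f a = f b) (s t : Bool) :
    cond s (a + 1) a ≠ cond t (b + 1) b := by
  cases s <;> cases t <;> simp only [cond]
  · exact hab
  · rintro rfl; exact h.ne_succ' b hf.symm
  · rintro rfl; exact h.ne_succ' a hf
  · simpa using hab

lemma endpoint_lt_iff (h : ArcSystem n f c)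
    {a b : ZMod n} (hab : a ≠ b) (hf : f a = f b) (s t : Bool)
    (hz : cond s (f (a + 1)) (f (a - 1)) = cond t (f (b + 1)) (f (b - 1))) :
    c (cond s (a + 1) a) (corner f a) < c (cond t (b + 1) b) (corner f a) ↔
    (corner f b = corner f a ∧ height c (corner f a) a < height c (corner f a) b) := by
  refine ⟨h.height_lt hab hf s t hz, fun ⟨h1, h2⟩ => ?_⟩
  by_contra hcon
  have hne : c (cond s (a + 1) a) (corner f a) ≠ c (cond t (b + 1) b) (corner f a) := by
    have hc := h.corner_ne a
    have a1 := h.ne_succ a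
    have a2 := h.ne_succ' a
    have b1 := h.ne_succ b
    have b2 := h.ne_succ' b
    have a3 := h.ne_two a
    refine (h.inj _ _ _ (cond s (f (a - 1)) (f (a + 1))) (h.endpoint_ne hab hf s t)
      ?_ ?_ ?_ ?_ ?_ ?_).1
    all_goals cases s <;> cases t <;> simp_all [eq_comm]
  have := h.height_lt hab.symm hf.symm t s hz.symm (by
    rw [h1]; exact lt_of_le_of_ne (not_lt.1 hcon) hne.symm)
  rw [h1] at this
  exact absurd this.2 (not_lt.2 h2.le)

/-- The rank of an arc at its corner agrees with the rank of each of its endpoints. -/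
lemma rank_endpoint (h : ArcSystem n f c) (a : ZMod n) (s : Bool) :
    rank f c (corner f a) (cond s (a + 1) a) =
      ((arcs f (corner f a) (f a)).filter fun b =>
        height c (corner f a) a < height c (corner f a) b).card := by
  have a1 := h.ne_succ a
  have a2 := h.ne_succ' a
  have e : edge f (f (cond s (a + 1) a - 1)) (f (cond s (a + 1) a)) =
      edge f (cond s (f (a + 1)) (f (a - 1))) (f a) := by
    cases s
    · rfl
    · simp only [cond, add_sub_cancel_right]; exact edge_comm _ _
  unfold rank
  rw [e, h.card_edge_filter (by cases s; exacts [a1, a2.symm])]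
  congr 1
  ext b
  simp only [mem_arcs, Finset.mem_filter, Finset.mem_univ, true_and]
  by_cases hf : f b = f a
  swap
  · simp [hf]
  by_cases hab : a = b
  · subst hab
    have a3 := h.ne_two a
    cases s <;> simp [a3, a3.symm]
  simp only [hf, true_and]
  constructor
  · rintro (⟨h1, h2⟩ | ⟨h1, h2⟩)
    · exact h.height_lt hab hf.symm s false h1.symm h2
    · exact h.height_lt hab hf.symm s true h1.symm h2
  · intro h3
    have hu := h.fourth_unique a b hf.symm h3.1.symm
    have : ∃ t : Bool, cond s (f (a + 1)) (f (a - 1)) = cond t (f (b + 1)) (f (b - 1)) := by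
      rcases hu with hu | hu
      · exact ⟨s, by cases s <;> simp [hu]⟩
      · exact ⟨!s, by cases s <;> simp [hu]⟩
    obtain ⟨t, ht⟩ := this
    have := (h.endpoint_lt_iff hab hf.symm s t ht).2 h3
    cases t
    · exact Or.inl ⟨ht.symm, this⟩
    · exact Or.inr ⟨ht.symm, this⟩

end ArcSystem
end TetraGeodesic

namespace TetraGeodesic
set_option linter.unusedSectionVars false

lemma exists_parity (K : Fin 4 → Fin 4 → ℕ) (hK : ∀ x y v w, x ≠ y → x ≠ v → x ≠ w → y ≠ v →
    y ≠ w → v ≠ w → K x w + K y w = K x v + K y v) :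
    ∃ g : Fin 4 → ℕ, ∀ x y w, x ≠ y → x ≠ w → y ≠ w → Even (K x w + K y w + (g x + g y)) := by
  refine ⟨![0, K 0 2 + K 1 2, K 0 1 + K 2 1, K 0 1 + K 3 1], ?_⟩
  have h1 := hK 0 1 2 3 (by decide) (by decide) (by decide) (by decide) (by decide) (by decide)
  have h2 := hK 0 2 1 3 (by decide) (by decide) (by decide) (by decide) (by decide) (by decide)
  have h3 := hK 0 3 1 2 (by decide) (by decide) (by decide) (by decide) (by decide) (by decide)
  have h4 := hK 1 2 0 3 (by decide) (by decide) (by decide) (by decide) (by decide) (by decide)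
  have h5 := hK 1 3 0 2 (by decide) (by decide) (by decide) (by decide) (by decide) (by decide)
  have h6 := hK 2 3 0 1 (by decide) (by decide) (by decide) (by decide) (by decide) (by decide)
  clear hK
  intro x y w hxy hxw hyw
  rw [Nat.even_iff]
  fin_cases x <;> fin_cases y <;> first | exact absurd rfl hxy | skip
  all_goals fin_cases w <;> first | exact absurd rfl hxw | exact absurd rfl hyw | skip
  all_goals (simp; omega)

namespace ArcSystem

variable {n : ℕ} [NeZero n] {f : ZMod n → Fin 4} {c : ZMod n → Fin 4 → ℝ}

lemma OnEdge.edge_eq {v w : Fin 4} {i : ZMod n} (hi : OnEdge f v w i) :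
    edge f (f (i - 1)) (f i) = edge f v w := by
  rcases hi with ⟨h1, h2⟩ | ⟨h1, h2⟩
  · rw [h1, h2]
  · rw [h1, h2, edge_comm]

lemma card_edge (h : ArcSystem n f c)
    {x y v w : Fin 4} (hxy : x ≠ y) (hxv : x ≠ v) (hxw : x ≠ w) (hyv : y ≠ v)
    (hyw : y ≠ w) (hvw : v ≠ w) :
    (edge f v w).card = (arcs f x w).card + (arcs f y w).card := by
  have h1 := h.card_edge_filter hvw (fun _ => True)
  rw [Finset.filter_true_of_mem (fun _ _ => trivial)] at h1
  rw [h1, ← Finset.card_union_of_disjoint]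
  · congr 1
    ext b
    simp only [Finset.mem_filter, Finset.mem_univ, true_and, and_true, Finset.mem_union, mem_arcs,
      ← and_or_left]
    refine and_congr_right fun hb => ?_
    have h2 := h.corner_ne b
    have a1 := h.ne_succ b
    have a2 := h.ne_succ' b
    have a3 := h.ne_two b
    rw [hb] at h2 a1 a2
    generalize f (b - 1) = b0 at *
    generalize f (b + 1) = b0 at *
    generalize corner f b = b0 at *
    clear h h1 hb
    omega
  · rw [Finset.disjoint_left]
    intro a ha hb
    rw [mem_arcs] at ha hb
    exact hxy (ha.2.symm.trans hb.2)

lemma coord_ne (h : ArcSystem n f c)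
    {v w y : Fin 4} (hy : y ≠ v) (hy' : y ≠ w) {i j : ZMod n} (hi : OnEdge f v w i)
    (hj : OnEdge f v w j) (hij : i ≠ j) : c i y ≠ c j y := by
  obtain ⟨z, hz⟩ : ∃ z, z ≠ v ∧ z ≠ w ∧ y ≠ z := by
    clear hi hj; revert v w y; decide
  have := h.inj i j y z hij
  rcases hi with ⟨h1, h2⟩ | ⟨h1, h2⟩ <;> rcases hj with ⟨h3, h4⟩ | ⟨h3, h4⟩ <;>
    simp_all

lemma rank_add_rank (h : ArcSystem n f c)
    {y z : Fin 4} {i : ZMod n} (hy : y ≠ f (i - 1)) (hy' : y ≠ f i)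
    (hz : z ≠ f (i - 1)) (hz' : z ≠ f i) (hyz : y ≠ z) :
    rank f c y i + rank f c z i + 1 = (edge f (f (i - 1)) (f i)).card := by
  unfold rank
  rw [← Finset.card_filter_add_card_filter_not (s := edge f (f (i - 1)) (f i))
    (fun j => c i y < c j y), add_assoc]
  congr 1
  have : (edge f (f (i - 1)) (f i)).filter (fun j => ¬ c i y < c j y) =
      insert i ((edge f (f (i - 1)) (f i)).filter (fun j => c i z < c j z)) := by
    ext j
    simp only [Finset.mem_filter, mem_edge, Finset.mem_insert]
    by_cases hij : i = j
    · subst hij; simp [onEdge_self]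
    have h1 : OnEdge f (f (i - 1)) (f i) j →
        (c i y ≠ c j y ∧ (c i y < c j y ↔ c j z < c i z)) :=
      h.inj i j y z hij hy hy' hz hz' hyz
    have h2 : OnEdge f (f (i - 1)) (f i) j → c i z ≠ c j z := fun hj =>
      h.coord_ne hz hz' (onEdge_self i) hj hij
    constructor
    · rintro ⟨hj, hc⟩
      rw [(h1 hj).2] at hc
      exact Or.inr ⟨hj, lt_of_le_of_ne (not_lt.1 hc) (h2 hj)⟩
    · rintro (rfl | ⟨hj, hc⟩)
      · exact absurd rfl hij
      · refine ⟨hj, ?_⟩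
        rw [(h1 hj).2]
        exact hc.le.not_gt
  rw [this, Finset.card_insert_of_notMem (by simp)]

lemma rank_endpoint_lt (h : ArcSystem n f c) (a : ZMod n) (s : Bool) :
    rank f c (corner f a) (cond s (a + 1) a) < (arcs f (corner f a) (f a)).card := by
  rw [h.rank_endpoint]
  exact rank_lt_card _ _ (mem_arcs.2 ⟨rfl, rfl⟩)

lemma exists_parity (h : ArcSystem n f c) :
    ∃ g : Fin 4 → ℕ, ∀ x y w, x ≠ y → x ≠ w → y ≠ w →
      Even ((arcs f x w).card + (arcs f y w).card + (g x + g y)) := by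
  refine TetraGeodesic.exists_parity (fun x w => (arcs f x w).card) ?_
  intro x y v w hxy hxv hxw hyv hyw hvw
  rw [← h.card_edge hxy hxv hxw hyv hyw hvw, ← h.card_edge hxy hxw hxv hyw hyv hvw.symm, edge_comm]

/-- The region to the left of the curve has a constant colour. -/
lemma exists_colour (h : ArcSystem n f c) {g : Fin 4 → ℕ} (hg : ∀ x y w, x ≠ y → x ≠ w → y ≠ w →
      Even ((arcs f x w).card + (arcs f y w).card + (g x + g y))) :
    ∃ G : ℤ, ∀ i y, y ≠ f (i - 1) → y ≠ f i →
      cornerSign y (f (i - 1)) (f i) = G * (-1) ^ (g y + rank f c y i) := by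
  have indep : ∀ i y z, y ≠ f (i - 1) → y ≠ f i → z ≠ f (i - 1) → z ≠ f i →
      cornerSign y (f (i - 1)) (f i) * (-1) ^ (g y + rank f c y i) =
      cornerSign z (f (i - 1)) (f i) * (-1) ^ (g z + rank f c z i) := by
    intro i y z hy hy' hz hz'
    rcases eq_or_ne y z with rfl | hyz
    · rfl
    rw [cornerSign_other y z _ _ hyz hy hy' hz hz' (h.ne_succ i)]
    have h1 := h.rank_add_rank hy hy' hz hz' hyz
    rw [h.card_edge hyz hy hy' hz hz' (h.ne_succ i)] at h1
    have h2 := hg y z (f i) hyz hy' hz'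
    rw [← h1] at h2
    have h3 : Odd ((g y + rank f c y i) + (g z + rank f c z i)) := by
      rw [Nat.even_iff] at h2; rw [Nat.odd_iff]; omega
    have h4 := h3.neg_one_pow (α := ℤ)
    rw [pow_add] at h4
    rcases neg_one_pow_eq_or ℤ (g y + rank f c y i) with h5 | h5 <;> rw [h5] at h4 ⊢
    · linear_combination cornerSign y (f (i - 1)) (f i) * h4
    · linear_combination (-cornerSign y (f (i - 1)) (f i)) * h4
  obtain ⟨y0, hy0⟩ : ∃ y, y ≠ f (0 - 1) ∧ y ≠ f 0 :=
    ⟨_, (h.corner_ne 0).1, (h.corner_ne 0).2.1⟩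
  have key : ∀ m : ℕ, ∀ y, y ≠ f ((m : ZMod n) - 1) → y ≠ f (m : ZMod n) →
      cornerSign y (f ((m : ZMod n) - 1)) (f (m : ZMod n)) * (-1) ^ (g y + rank f c y m) =
      cornerSign y0 (f (0 - 1)) (f 0) * (-1) ^ (g y0 + rank f c y0 0) := by
    intro m
    induction m with
    | zero =>
      intro y hy hy'
      simp only [Nat.cast_zero] at hy hy' ⊢
      exact indep 0 y y0 hy hy' hy0.1 hy0.2
    | succ m ih =>
      intro y hy hy'
      set i : ZMod n := (m : ZMod n) with hi
      obtain ⟨x1, x2, x3⟩ := h.corner_ne i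
      rw [← ih _ x1 x2]
      have e := h.rank_endpoint i true
      rw [← h.rank_endpoint i false] at e
      simp only [cond] at e
      push_cast at hy hy' ⊢
      rw [← hi] at hy hy' ⊢
      rw [indep (i + 1) y (corner f i) hy hy' (by simpa using x2) x3, e]
      simp only [add_sub_cancel_right]
      rw [cornerSign_rotate _ _ _ _ x1 x2 x3 (h.ne_succ i) (h.ne_two i) (h.ne_succ' i)]
  refine ⟨cornerSign y0 (f (0 - 1)) (f 0) * (-1) ^ (g y0 + rank f c y0 0), fun i y hy hy' => ?_⟩
  have := key i.val y
  rw [ZMod.natCast_zmod_val] at this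
  rw [← this hy hy', mul_assoc, ← pow_add, Even.neg_one_pow ⟨_, rfl⟩, mul_one]

lemma height_injOn (h : ArcSystem n f c)
    (x w : Fin 4) : Set.InjOn (height c x) (arcs f x w : Set (ZMod n)) := by
  intro a ha b hb hab
  rw [Finset.mem_coe, mem_arcs] at ha hb
  by_contra hne
  have hf := ha.1.trans hb.1.symm
  have hx := ha.2.trans hb.2.symm
  obtain ⟨t, ht⟩ : ∃ t : Bool, f (a - 1) = cond t (f (b + 1)) (f (b - 1)) := by
    rcases h.fourth_unique a b hf hx with hu | hu
    exacts [⟨false, hu.1.symm⟩, ⟨true, hu.2.symm⟩]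
  have h1 := h.endpoint_lt_iff hne hf false t ht
  have h2 := h.endpoint_lt_iff (Ne.symm hne) hf.symm t false ht.symm
  rw [hx.symm] at h2
  simp only [ha.2, hb.2, hab, lt_self_iff_false, and_false, iff_false, not_lt] at h1 h2
  have hc := h.corner_ne a
  refine h.coord_ne (y := x) (v := f (a - 1)) (w := f a) (ha.2 ▸ hc.1) (ha.2 ▸ hc.2.1)
    (i := cond false (a + 1) a) (j := cond t (b + 1) b) (onEdge_self a) ?_
    (h.endpoint_ne hne hf false t) (le_antisymm h2 h1)
  cases t
  · exact Or.inl ⟨ht.symm, hf.symm⟩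
  · exact Or.inr ⟨by simpa using hf.symm, ht.symm⟩

/-- Signed sums over the arcs reduce to sums over the corners met by an odd number of arcs. -/
lemma sum_cornerSign (h : ArcSystem n f c)
    {g : Fin 4 → ℕ} {G : ℤ} (hG : ∀ i y, y ≠ f (i - 1) → y ≠ f i →
      cornerSign y (f (i - 1)) (f i) = G * (-1) ^ (g y + rank f c y i))
    (θ : Fin 4 → Fin 4 → ℝ) :
    ∑ a, (cornerSign (corner f a) (f (a - 1)) (f a) : ℝ) * θ (corner f a) (f a) =
      G * ∑ x, ∑ w, (-1) ^ g x * (if Odd (arcs f x w).card then θ x w else 0) := by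
  rw [← Finset.sum_fiberwise (s := Finset.univ) (g := corner f), Finset.mul_sum]
  refine Finset.sum_congr rfl fun x _ => ?_
  rw [← Finset.sum_fiberwise (s := Finset.univ.filter fun i => corner f i = x) (g := f),
    Finset.mul_sum]
  refine Finset.sum_congr rfl fun w _ => ?_
  have e : (Finset.univ.filter fun i => corner f i = x).filter (fun i => f i = w) = arcs f x w := by
    ext a; simp [mem_arcs, and_comm]
  rw [e]
  have h1 := sum_neg_one_pow_rank (arcs f x w) (height c x) (h.height_injOn x w)
  have : ∀ a ∈ arcs f x w, (cornerSign (corner f a) (f (a - 1)) (f a) : ℝ) * θ (corner f a) (f a) =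
      (G * (-1) ^ g x * θ x w) *
        (-1) ^ ((arcs f x w).filter fun j => height c x a < height c x j).card := by
    intro a ha
    obtain ⟨h2, h3⟩ := mem_arcs.1 ha
    obtain ⟨x1, x2, x3⟩ := h.corner_ne a
    have e := h.rank_endpoint a false
    simp only [cond] at e
    rw [hG a _ x1 x2, e, h2, h3]
    push_cast
    ring
  rw [Finset.sum_congr rfl this, ← Finset.mul_sum, h1]
  split_ifs <;> ring

/-- The arcs cannot all come in parallel pairs. -/
lemma exists_odd (h : ArcSystem n f c) : ∃ x w, x ≠ w ∧ Odd (arcs f x w).card := by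
  by_contra! hcon
  have hK : ∀ x w, x ≠ w → Even (arcs f x w).card := fun x w hxw => by
    simpa using hcon x w hxw
  obtain ⟨g, hg⟩ := h.exists_parity
  obtain ⟨G, hG⟩ := h.exists_colour hg
  have hE : ∀ i, Even (edge f (f (i - 1)) (f i)).card := by
    intro i
    obtain ⟨y, z, h1, h2, h3, h4, h5⟩ : ∃ y z, y ≠ f (i - 1) ∧ y ≠ f i ∧ z ≠ f (i - 1) ∧ z ≠ f i ∧
        y ≠ z := by
      generalize f (i - 1) = p
      generalize f i = q
      revert p q; decide
    rw [h.card_edge h5 h1 h2 h3 h4 (h.ne_succ i)]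
    exact (hK _ _ h2).add (hK _ _ h4)
  let Pair : ZMod n → ZMod n → Prop := fun i j => OnEdge f (f (i - 1)) (f i) j ∧
    ∃ y, y ≠ f (i - 1) ∧ y ≠ f i ∧ rank f c y i ≠ rank f c y j ∧
      rank f c y i / 2 = rank f c y j / 2
  have step : ∀ i j, Pair i j → Pair (i + 1) (j - 1) := by
    rintro i j ⟨hij, y, hy, hy', hne, hhalf⟩
    obtain ⟨x1, x2, x3⟩ := h.corner_ne i
    have hEi := hE i
    have hedge := hij.edge_eq
    have on : ∀ y, y ≠ f (i - 1) → y ≠ f i → y ≠ f (j - 1) ∧ y ≠ f j := by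
      intro y hy hy'
      rcases hij with ⟨h1, h2⟩ | ⟨h1, h2⟩ <;> simp [h1, h2, hy, hy']
    have hx : rank f c (corner f i) i ≠ rank f c (corner f i) j ∧
        rank f c (corner f i) i / 2 = rank f c (corner f i) j / 2 := by
      rcases eq_or_ne y (corner f i) with rfl | hyx
      · exact ⟨hne, hhalf⟩
      have h1 := h.rank_add_rank x1 x2 hy hy' hyx.symm
      have h2 := h.rank_add_rank (on _ x1 x2).1 (on _ x1 x2).2 (on _ hy hy').1 (on _ hy hy').2
        hyx.symm
      rw [hedge] at h2
      rw [Nat.even_iff] at hEi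
      omega
    have h1 := h.rank_endpoint_lt i false
    simp only [cond] at h1
    have h2 := Nat.even_iff.1 (hK _ _ x2)
    have hor : f (j - 1) = f i ∧ f j = f (i - 1) := by
      rcases hij with ⟨h3, h4⟩ | h3
      · exfalso
        have e1 := hG i _ x1 x2
        have e2 := hG j (corner f i) (on _ x1 x2).1 (on _ x1 x2).2
        rw [h3, h4, e1, pow_add, pow_add] at e2
        have hG0 : G * (-1) ^ g (corner f i) ≠ 0 := by
          intro h0
          rw [pow_add, ← mul_assoc, h0, zero_mul] at e1
          rcases cornerSign_eq_one_or _ _ _ x1 x2 (h.ne_succ i) with h5 | h5 <;> omega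
        rw [← mul_assoc, ← mul_assoc] at e2
        have e3 := mul_left_cancel₀ hG0 e2
        rcases Nat.even_or_odd (rank f c (corner f i) i) with p | p <;>
          rcases Nat.even_or_odd (rank f c (corner f i) j) with q | q
        · rw [Nat.even_iff] at p q; omega
        · rw [p.neg_one_pow, q.neg_one_pow] at e3; omega
        · rw [p.neg_one_pow, q.neg_one_pow] at e3; omega
        · rw [Nat.odd_iff] at p q; omega
      · exact h3
    have hcorner : corner f (j - 1) = corner f i := by
      by_contra hz
      have z := h.corner_ne (j - 1)
      simp only [sub_add_cancel, hor.1, hor.2] at z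
      have h3 := h.rank_endpoint_lt (j - 1) true
      simp only [cond, sub_add_cancel, hor.1] at h3
      have h4 := h.rank_add_rank (on _ x1 x2).1 (on _ x1 x2).2 (on _ z.2.2 z.2.1).1
        (on _ z.2.2 z.2.1).2 (Ne.symm hz)
      rw [hedge, h.card_edge (Ne.symm hz) x1 x2 z.2.2 z.2.1 (h.ne_succ i)] at h4
      omega
    have e1 := h.rank_endpoint (j - 1) true
    rw [← h.rank_endpoint (j - 1) false] at e1
    have e2 := h.rank_endpoint i true
    rw [← h.rank_endpoint i false] at e2
    simp only [cond, sub_add_cancel, hcorner] at e1 e2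
    refine ⟨Or.inr ⟨?_, ?_⟩, corner f i, ?_, x3, ?_⟩
    · have hu := h.fourth_unique (j - 1) i hor.1 hcorner
      have := h.ne_two i
      simp only [sub_add_cancel, hor.2] at hu
      rcases hu with hu | hu
      · exact absurd hu.2.symm this
      · exact hu.2.symm
    · simpa using hor.1
    · simpa using x2
    · rw [e2, ← e1]; exact hx
  have start : ∃ j, Pair 0 j := by
    obtain ⟨x1, x2, -⟩ := h.corner_ne 0
    set y := corner f 0
    set s := edge f (f (0 - 1)) (f 0) with hs
    have hinj : Set.InjOn (fun j => c j y) (s : Set (ZMod n)) := by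
      intro i hi j hj hij
      by_contra hne
      exact h.coord_ne x1 x2 (mem_edge.1 hi) (mem_edge.1 hj) hne hij
    have himg := image_rank s (fun j => c j y) hinj
    have hr : ∀ j ∈ s, rank f c y j = (s.filter fun k => c j y < c k y).card := by
      intro j hj
      unfold rank
      rw [(mem_edge.1 hj).edge_eq]
    have h0 : (0 : ZMod n) ∈ s := mem_edge.2 (onEdge_self 0)
    have hlt := rank_lt_card s (fun j => c j y) h0
    have hEs : s.card % 2 = 0 := Nat.even_iff.1 (hE 0)
    rw [← hr 0 h0] at hlt
    obtain ⟨r, hr1, hr2, hr3⟩ : ∃ r, r < s.card ∧ rank f c y 0 ≠ r ∧ rank f c y 0 / 2 = r / 2 := by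
      rcases Nat.even_or_odd (rank f c y 0) with p | p
      · rw [Nat.even_iff] at p
        exact ⟨rank f c y 0 + 1, by omega, by omega, by omega⟩
      · rw [Nat.odd_iff] at p
        exact ⟨rank f c y 0 - 1, by omega, by omega, by omega⟩
    have hmem : r ∈ s.image (fun i => (s.filter fun j => c i y < c j y).card) := by
      rw [himg]; exact Finset.mem_range.2 hr1
    obtain ⟨j, hj, hjr⟩ := Finset.mem_image.1 hmem
    rw [← hr j hj] at hjr
    exact ⟨j, mem_edge.1 hj, y, x1, x2, by rw [hjr]; exact hr2, by rw [hjr]; exact hr3⟩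
  obtain ⟨j, hj⟩ := start
  have all : ∀ m : ℕ, Pair (m : ZMod n) (j - m) := by
    intro m
    induction m with
    | zero => simpa using hj
    | succ m ih => convert step _ _ ih using 1 <;> push_cast <;> ring
  have hne : ∀ i, ¬ Pair i i := fun i hi => by
    obtain ⟨-, y, -, -, h1, -⟩ := hi
    exact h1 rfl
  have hne' : ∀ i, ¬ Pair i (i + 1) := fun i hi => by
    have a1 := h.ne_two i
    rcases hi.1 with ⟨h1, h2⟩ | ⟨h1, h2⟩
    · rw [add_sub_cancel_right] at h1
      exact h.ne_succ i h1.symm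
    · exact a1 h2.symm
  have hval : ((j.val : ℕ) : ZMod n) = j := ZMod.natCast_zmod_val j
  rcases Nat.even_or_odd' j.val with ⟨m, hm | hm⟩
  · have := all m
    rw [← hval, hm] at this
    refine hne m ?_
    convert this using 1
    push_cast; ring
  · have := all m
    rw [← hval, hm] at this
    refine hne' m ?_
    convert this using 1
    push_cast; ring

end ArcSystem
end TetraGeodesic

namespace TetraGeodesic

/-- Signed corner angles of one triangle, in terms of a colouring of its vertices. -/
lemma signed_triangle (a₁ a₂ a₃ : ℝ) (hsum : a₁ + a₂ + a₃ = Real.pi) (G₁ G₂ G₃ H : Bool) :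
    (bif G₁ then -1 else 1) * (bif G₁ != H then a₁ else 0) +
    (bif G₂ then -1 else 1) * (bif G₂ != H then a₂ else 0) +
    (bif G₃ then -1 else 1) * (bif G₃ != H then a₃ else 0) =
    (bif G₁ then 0 else a₁) + (bif G₂ then 0 else a₂) + (bif G₃ then 0 else a₃) -
      Real.pi * (bif H then 0 else 1) := by
  cases G₁ <;> cases G₂ <;> cases G₃ <;> cases H <;> simp <;> linarith

/-- Gauss-Bonnet for the two sides of the curve forces all corners to be met evenly. -/
lemma even_of_signed_sum {β : ℝ} (h1 : Real.pi / 6 < β) (h2 : β < Real.pi / 2)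
    (h3 : β ≠ Real.pi / 3) (K : Fin 4 → Fin 4 → ℕ) (g : Fin 4 → ℕ)
    (hK : ∀ x y w, x ≠ y → x ≠ w → y ≠ w → Even (K x w + K y w + (g x + g y)))
    (hK0 : ∀ x, K x x = 0) (θ : Fin 4 → Fin 4 → ℝ)
    (hθV : ∀ w, w ≠ 3 → θ 3 w = Real.pi - 2 * β)
    (hθb : ∀ x, x ≠ 3 → θ x 3 = Real.pi / 3)
    (hθl : ∀ x w, x ≠ 3 → w ≠ 3 → x ≠ w → θ x w = β)
    (hsum : ∑ x, ∑ w, (-1) ^ g x * (if Odd (K x w) then θ x w else 0) = 0) :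
    ∀ x w, x ≠ w → Even (K x w) := by
  have hodd : ∃ G H : Fin 4 → Bool, (∀ x, (-1 : ℝ) ^ g x = bif G x then -1 else 1) ∧
      ∀ x w, x ≠ w → (Odd (K x w) ↔ (G x != H w) = true) := by
    refine ⟨fun x => decide (Odd (g x)), fun w => if w = 0 then
      xor (decide (Odd (g 1))) (decide (Odd (K 1 w))) else
      xor (decide (Odd (g 0))) (decide (Odd (K 0 w))), ?_, ?_⟩
    · intro x
      rcases Nat.even_or_odd (g x) with p | p
      · simp [p.neg_one_pow, Nat.not_odd_iff_even.2 p]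
      · simp [p.neg_one_pow, p]
    · intro x w hxw
      obtain ⟨y, hy, hyw⟩ : ∃ y, (y = if w = 0 then 1 else 0) ∧ y ≠ w := by
        by_cases hw : w = 0
        · exact ⟨1, by simp [hw], by simp [hw]⟩
        · exact ⟨0, by simp [hw], Ne.symm hw⟩
      have e : (if w = 0 then xor (decide (Odd (g 1))) (decide (Odd (K 1 w))) else
          xor (decide (Odd (g 0))) (decide (Odd (K 0 w)))) =
          xor (decide (Odd (g y))) (decide (Odd (K y w))) := by
        by_cases hw : w = 0 <;> simp [hw, hy]
      simp only [e]
      rcases eq_or_ne x y with rfl | hxy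
      · cases decide (Odd (g x)) <;> simp
      have := hK x y w hxy hxw hyw
      by_cases p1 : Odd (K x w) <;> by_cases p2 : Odd (K y w) <;> by_cases p3 : Odd (g x) <;>
        by_cases p4 : Odd (g y) <;> simp [p1, p2, p3, p4] <;>
        (rw [Nat.odd_iff] at p1 p2 p3 p4; rw [Nat.even_iff] at this; omega)
  obtain ⟨G, H, hG, hH⟩ := hodd
  have hterm : ∀ x w, x ≠ w → (if Odd (K x w) then θ x w else 0) =
      bif G x != H w then θ x w else 0 := by
    intro x w hxw
    have := hH x w hxw
    by_cases p : Odd (K x w)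
    · rw [if_pos p, this.1 p]; rfl
    · rw [if_neg p, Bool.eq_false_iff.2 (mt this.2 p)]; rfl
  simp only [Fin.sum_univ_four, hG] at hsum
  rw [hterm 0 1 (by decide), hterm 0 2 (by decide), hterm 0 3 (by decide),
    hterm 1 0 (by decide), hterm 1 2 (by decide), hterm 1 3 (by decide),
    hterm 2 0 (by decide), hterm 2 1 (by decide), hterm 2 3 (by decide),
    hterm 3 0 (by decide), hterm 3 1 (by decide), hterm 3 2 (by decide)] at hsum
  simp only [hK0] at hsum
  rw [hθV 0 (by decide), hθV 1 (by decide), hθV 2 (by decide), hθb 0 (by decide),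
    hθb 1 (by decide), hθb 2 (by decide), hθl 0 1 (by decide) (by decide) (by decide),
    hθl 0 2 (by decide) (by decide) (by decide), hθl 1 0 (by decide) (by decide) (by decide),
    hθl 1 2 (by decide) (by decide) (by decide), hθl 2 0 (by decide) (by decide) (by decide),
    hθl 2 1 (by decide) (by decide) (by decide)] at hsum
  simp only [Nat.not_odd_zero, if_false, mul_zero] at hsum
  have f0 := signed_triangle β β (Real.pi - 2 * β) (by ring) (G 1) (G 2) (G 3) (H 0)
  have f1 := signed_triangle β β (Real.pi - 2 * β) (by ring) (G 0) (G 2) (G 3) (H 1)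
  have f2 := signed_triangle β β (Real.pi - 2 * β) (by ring) (G 0) (G 1) (G 3) (H 2)
  have f3 := signed_triangle (Real.pi / 3) (Real.pi / 3) (Real.pi / 3) (by ring) (G 0) (G 1) (G 2)
    (H 3)
  have hpi := Real.pi_pos
  suffices hs : (∀ x w, G x = H w) by
    intro x w hxw
    rw [← Nat.not_odd_iff_even, hH x w hxw, hs x w]
    simp
  obtain ⟨N, hN, hN4⟩ : ∃ N : ℕ, (bif H 0 then 0 else 1) + (bif H 1 then 0 else 1) +
      (bif H 2 then 0 else 1) + (bif H 3 then 0 else 1) = N ∧ N ≤ 4 := by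
    refine ⟨_, rfl, ?_⟩
    cases H 0 <;> cases H 1 <;> cases H 2 <;> cases H 3 <;> simp
  have hN' : (bif H 0 then 0 else 1) + (bif H 1 then 0 else 1) +
      (bif H 2 then 0 else 1) + (bif H 3 then 0 else 1) = (N : ℝ) := by
    rw [← hN]
    cases H 0 <;> cases H 1 <;> cases H 2 <;> cases H 3 <;> norm_num
  have total : (bif G 0 then 0 else Real.pi / 3 + 2 * β) +
      (bif G 1 then 0 else Real.pi / 3 + 2 * β) + (bif G 2 then 0 else Real.pi / 3 + 2 * β) +
      (bif G 3 then 0 else 3 * (Real.pi - 2 * β)) = Real.pi * N := by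
    rw [← hN']
    have e : ∀ (b : Bool), (bif b then 0 else Real.pi / 3 + 2 * β) =
        (bif b then 0 else Real.pi / 3) + 2 * (bif b then 0 else β) := by
      intro b; cases b <;> simp
    have e' : ∀ (b : Bool), (bif b then 0 else 3 * (Real.pi - 2 * β)) =
        3 * (bif b then 0 else (Real.pi - 2 * β)) := by
      intro b; cases b <;> simp
    simp only [e, e']
    linarith
  clear f0 f1 f2 f3 hsum hN' hterm hH hG
  have allG : (∀ x, G x = true) ∧ N = 0 ∨ (∀ x, G x = false) ∧ N = 4 := by
    have hG4 : ∀ b, G 0 = b → G 1 = b → G 2 = b → G 3 = b → ∀ x, G x = b := by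
      intro b g0 g1 g2 g3 x
      fin_cases x <;> assumption
    have hlt : β < Real.pi / 3 ∨ Real.pi / 3 < β := lt_or_gt_of_ne h3
    rcases g0 : G 0 <;> rcases g1 : G 1 <;> rcases g2 : G 2 <;> rcases g3 : G 3
    · exact Or.inr ⟨hG4 _ g0 g1 g2 g3, by
        simp only [g0, g1, g2, g3, cond] at total
        interval_cases N <;> first | rfl | (exfalso; push_cast at total; linarith)⟩
    on_goal 15 => exact Or.inl ⟨hG4 _ g0 g1 g2 g3, by
        simp only [g0, g1, g2, g3, cond] at total
        interval_cases N <;> first | rfl | (exfalso; push_cast at total; linarith)⟩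
    all_goals
      exfalso
      simp only [g0, g1, g2, g3, cond] at total
      interval_cases N <;> push_cast at total <;> rcases hlt with hlt | hlt <;> linarith
  have hH4 : ∀ b, H 0 = b → H 1 = b → H 2 = b → H 3 = b → ∀ x, H x = b := by
    intro b g0 g1 g2 g3 x
    fin_cases x <;> assumption
  rcases allG with ⟨hg, rfl⟩ | ⟨hg, rfl⟩
  · have : ∀ x, H x = true := by
      apply hH4 <;> revert hN <;>
        cases H 0 <;> cases H 1 <;> cases H 2 <;> cases H 3 <;> simp
    intro x w; rw [hg, this]
  · have : ∀ x, H x = false := by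
      apply hH4 <;> revert hN <;>
        cases H 0 <;> cases H 1 <;> cases H 2 <;> cases H 3 <;> simp
    intro x w; rw [hg, this]

end TetraGeodesic

namespace TetraGeodesic

open Set

/-- Two points of a tetrahedron which lie on a common face. -/
def SameFace (b : AffineBasis (Fin 4) ℝ (EuclideanSpace ℝ (Fin 3)))
    (p q : EuclideanSpace ℝ (Fin 3)) : Prop :=
  (∀ w, 0 ≤ b.coord w p) ∧ (∀ w, 0 ≤ b.coord w q) ∧ ∃ w, b.coord w p = 0 ∧ b.coord w q = 0

/-- A periodic simple curve on the surface of a tetrahedron, locally no longer than polygonal lines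
with three edges which are contained in faces. -/
structure LocallyShortest (b : AffineBasis (Fin 4) ℝ (EuclideanSpace ℝ (Fin 3)))
    (γ : ℝ → EuclideanSpace ℝ (Fin 3)) : Prop where
  cont : Continuous γ
  periodic : Function.Periodic γ 1
  injOn : InjOn γ (Ico (0 : ℝ) 1)
  nonneg : ∀ t w, 0 ≤ b.coord w (γ t)
  exists_zero : ∀ t, ∃ w, b.coord w (γ t) = 0
  short : ∀ t, ∃ ε > (0 : ℝ), ∀ s₁ s s₂, t - ε < s₁ → s₁ ≤ s → s ≤ s₂ → s₂ < t + ε →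
    ∀ p q, SameFace b (γ s₁) p → SameFace b p q → SameFace b q (γ s₂) →
    dist (γ s₁) (γ s) + dist (γ s) (γ s₂) ≤ dist (γ s₁) p + dist p q + dist q (γ s₂)

lemma mem_frontier_convexHull_iff (b : AffineBasis (Fin 4) ℝ (EuclideanSpace ℝ (Fin 3)))
    (x : EuclideanSpace ℝ (Fin 3)) :
    x ∈ frontier (convexHull ℝ (range b)) ↔
      (∀ w, 0 ≤ b.coord w x) ∧ ∃ w, b.coord w x = 0 := by
  have hc : IsClosed (convexHull ℝ (range b)) :=
    (Set.finite_range b).isClosed_convexHull ℝ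
  rw [hc.frontier_eq, AffineBasis.interior_convexHull, AffineBasis.convexHull_eq_nonneg_coord]
  constructor
  · rintro ⟨h1, h2⟩
    refine ⟨h1, ?_⟩
    by_contra! h
    exact h2 fun i => lt_of_le_of_ne (h1 i) (h i).symm
  · rintro ⟨h1, w, hw⟩
    exact ⟨h1, fun h => absurd (h w) (by simp [hw])⟩

/-- There is a path in `F` from `x` to `y` of length at most `L`. -/
def Reach (F : Set (EuclideanSpace ℝ (Fin 3))) (x y : EuclideanSpace ℝ (Fin 3)) (L : ℝ) : Prop :=
  ∃ (a b : ℝ) (c : ℝ → EuclideanSpace ℝ (Fin 3)), a ≤ b ∧ Continuous c ∧ c a = x ∧ c b = y ∧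
    (∀ t ∈ Icc a b, c t ∈ F) ∧ eVariationOn c (Icc a b) ≤ ENNReal.ofReal L

lemma Reach.append {F : Set (EuclideanSpace ℝ (Fin 3))} {x y z : EuclideanSpace ℝ (Fin 3)} {L : ℝ}
    (hL : 0 ≤ L) (h : Reach F x y L) (hs : segment ℝ y z ⊆ F) : Reach F x z (L + dist y z) := by
  obtain ⟨a, b, c, hab, hc, rfl, rfl, hF, hv⟩ := h
  let d : ℝ → EuclideanSpace ℝ (Fin 3) := fun t => c (min t b) + max (t - b) 0 • (z - c b)
  have d1 : EqOn d c (Icc a b) := by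
    intro t ht
    simp [d, min_eq_left ht.2, max_eq_right (sub_nonpos.2 ht.2)]
  let e : ℝ → EuclideanSpace ℝ (Fin 3) := fun t => AffineMap.lineMap (c b) z t
  have d2 : EqOn d (e ∘ fun t => t - b) (Icc b (b + 1)) := by
    intro t ht
    simp [d, e, min_eq_right ht.1, max_eq_left (sub_nonneg.2 ht.1), AffineMap.lineMap_apply,
      add_comm]
  refine ⟨a, b + 1, d, by linarith, by fun_prop, ?_, ?_, ?_, ?_⟩
  · rw [d1 ⟨le_rfl, hab⟩]
  · rw [d2 ⟨by linarith, le_rfl⟩]; simp [e]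
  · intro t ht
    rcases le_total t b with h | h
    · rw [d1 ⟨ht.1, h⟩]; exact hF t ⟨ht.1, h⟩
    · rw [d2 ⟨h, ht.2⟩]
      apply hs
      rw [segment_eq_image_lineMap]
      exact ⟨t - b, ⟨by linarith, by linarith [ht.2]⟩, rfl⟩
  · rw [← univ_inter (Icc a (b+1)), ← eVariationOn.Icc_add_Icc d hab (by linarith : b ≤ b + 1) (mem_univ _),
      univ_inter, univ_inter, ENNReal.ofReal_add hL dist_nonneg]
    refine add_le_add ((eVariationOn.congr d1).le.trans hv) ?_
    rw [eVariationOn.congr d2]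
    have hl : LipschitzWith (nndist (c b) z) e := lipschitzWith_lineMap (c b) z
    refine ((hl.lipschitzOnWith (s := univ)).comp_eVariationOn_le (fun _ _ => mem_univ _)).trans ?_
    have hm : MonotoneOn (fun t : ℝ => t - b) univ := fun x _ y _ h => by simpa using h
    have := hm.eVariationOn_eq (a := b) (b := b + 1) (mem_univ _) (mem_univ _)
    rw [univ_inter] at this
    calc _ ≤ (nndist (c b) z : ENNReal) * 1 := by
            gcongr; exact this.le.trans (by simp)
      _ = _ := by simp [edist_dist]

lemma Reach.refl {F : Set (EuclideanSpace ℝ (Fin 3))} {x : EuclideanSpace ℝ (Fin 3)} (hx : x ∈ F) :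
    Reach F x x 0 :=
  ⟨0, 0, fun _ => x, le_rfl, continuous_const, rfl, rfl, fun _ _ => hx, by
    rw [Icc_self, eVariationOn.subsingleton _ subsingleton_singleton]; simp⟩

lemma SameFace.segment_subset {b : AffineBasis (Fin 4) ℝ (EuclideanSpace ℝ (Fin 3))}
    {p q : EuclideanSpace ℝ (Fin 3)} (h : SameFace b p q) :
    segment ℝ p q ⊆ frontier (convexHull ℝ (range b)) := by
  obtain ⟨h1, h2, w, h3, h4⟩ := h
  rw [segment_eq_image_lineMap]
  rintro _ ⟨t, ⟨ht0, ht1⟩, rfl⟩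
  rw [mem_frontier_convexHull_iff]
  refine ⟨fun v => ?_, w, ?_⟩
  · rw [AffineMap.apply_lineMap, AffineMap.lineMap_apply_ring]
    have := mul_nonneg ht0 (h2 v)
    have := mul_nonneg (sub_nonneg.2 ht1) (h1 v)
    linarith
  · rw [AffineMap.apply_lineMap, h3, h4]; simp

lemma _root_.IsSimpleClosedGeodesicIn.locallyShortest
    {b : AffineBasis (Fin 4) ℝ (EuclideanSpace ℝ (Fin 3))} {γ : ℝ → EuclideanSpace ℝ (Fin 3)}
    (h : IsSimpleClosedGeodesicIn (frontier (convexHull ℝ (range b))) γ) :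
    LocallyShortest b γ := by
  obtain ⟨h1, h2, h3, h4, -, -, h5⟩ := h
  refine ⟨h1, h2, h3, fun t => ((mem_frontier_convexHull_iff b _).1 (h4 t)).1,
    fun t => ((mem_frontier_convexHull_iff b _).1 (h4 t)).2, fun t => ?_⟩
  obtain ⟨ε, hε, H⟩ := h5 t
  refine ⟨ε, hε, fun s₁ s s₂ g1 g2 g3 g4 p q hp hpq hq => ?_⟩
  have hr := (((Reach.refl (h4 s₁)).append le_rfl hp.segment_subset).append (by positivity)
    hpq.segment_subset).append (by positivity) hq.segment_subset
  obtain ⟨a, b', c, hab, hc, hca, hcb, hF, hv⟩ := hr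
  have := (H s₁ s₂ ⟨g1, by linarith⟩ ⟨by linarith, g4⟩ (g2.trans g3) a b' c hab hc.continuousOn
    hca hcb hF).trans hv
  rw [← univ_inter (Icc s₁ s₂), ← eVariationOn.Icc_add_Icc γ g2 g3 (mem_univ _),
      univ_inter, univ_inter] at this
  have k1 := eVariationOn.edist_le γ (left_mem_Icc.2 g2) (right_mem_Icc.2 g2)
  have k2 := eVariationOn.edist_le γ (left_mem_Icc.2 g3) (right_mem_Icc.2 g3)
  have := (add_le_add k1 k2).trans this
  rw [edist_dist, edist_dist, ← ENNReal.ofReal_add dist_nonneg dist_nonneg,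
    ENNReal.ofReal_le_ofReal_iff (by positivity)] at this
  linarith

end TetraGeodesic

namespace TetraGeodesic

open Set InnerProductGeometry

section RayPath

variable {W : Type*} [NormedAddCommGroup W] [InnerProductSpace ℝ W]

/-- The distance between points of two rays, in polar coordinates `h / cos φ`. -/
lemma norm_sub_of_angle_eq {e₁ e₂ : W} (he₁ : e₁ ≠ 0) (he₂ : e₂ ≠ 0) {φ₁ φ₂ h : ℝ} (hh : 0 ≤ h)
    (hang : angle e₁ e₂ = φ₂ - φ₁) (hφ : φ₁ ≤ φ₂) (h1 : -(Real.pi / 2) < φ₁)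
    (h2 : φ₂ < Real.pi / 2) :
    ‖(h / Real.cos φ₁ / ‖e₁‖) • e₁ - (h / Real.cos φ₂ / ‖e₂‖) • e₂‖ =
      h * (Real.tan φ₂ - Real.tan φ₁) := by
  have c1 : 0 < Real.cos φ₁ := Real.cos_pos_of_mem_Ioo ⟨h1, hφ.trans_lt h2⟩
  have c2 : 0 < Real.cos φ₂ := Real.cos_pos_of_mem_Ioo ⟨h1.trans_le hφ, h2⟩
  have n1 : 0 < ‖e₁‖ := norm_pos_iff.2 he₁
  have n2 : 0 < ‖e₂‖ := norm_pos_iff.2 he₂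
  have htan : 0 ≤ Real.tan φ₂ - Real.tan φ₁ := by
    have := (Real.strictMonoOn_tan.monotoneOn) ⟨h1, hφ.trans_lt h2⟩ ⟨h1.trans_le hφ, h2⟩ hφ
    linarith
  rw [← sq_eq_sq₀ (norm_nonneg _) (mul_nonneg hh htan), norm_sub_sq_real, real_inner_smul_left,
    real_inner_smul_right, ← cos_angle_mul_norm_mul_norm, hang, Real.cos_sub, norm_smul, norm_smul]
  simp only [Real.norm_eq_abs]
  rw [abs_of_nonneg (by positivity), abs_of_nonneg (by positivity), Real.tan_eq_sin_div_cos,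
    Real.tan_eq_sin_div_cos]
  field_simp
  have s1 := Real.sin_sq_add_cos_sq φ₁
  have s2 := Real.sin_sq_add_cos_sq φ₂
  linear_combination (-h^2*Real.cos φ₂^2) * s1 + (-h^2*Real.cos φ₁^2)*s2

/-- If three successive angles at a point add up to less than `π`, then there is a shortcut. -/
lemma exists_ray_path {e₀ e₁ e₂ e₃ : W} (he₀ : e₀ ≠ 0) (he₁ : e₁ ≠ 0) (he₂ : e₂ ≠ 0) {r : ℝ}
    (h₀ : ‖e₀‖ = r) (h₃ : ‖e₃‖ = r)
    (hang : angle e₀ e₁ + angle e₁ e₂ + angle e₂ e₃ < Real.pi) :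
    ∃ s₁ s₂ : ℝ, 0 ≤ s₁ ∧ 0 ≤ s₂ ∧ s₁ * ‖e₁‖ ≤ r ∧ s₂ * ‖e₂‖ ≤ r ∧
      ‖e₀ - s₁ • e₁‖ + ‖s₁ • e₁ - s₂ • e₂‖ + ‖s₂ • e₂ - e₃‖ < 2 * r := by
  have hr : 0 < r := h₀ ▸ norm_pos_iff.2 he₀
  have he₃ : e₃ ≠ 0 := norm_pos_iff.1 (h₃ ▸ hr)
  set α := angle e₀ e₁ with hα
  set β := angle e₁ e₂ with hβ
  set δ := angle e₂ e₃ with hδ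
  have α0 : 0 ≤ α := angle_nonneg _ _
  have β0 : 0 ≤ β := angle_nonneg _ _
  have δ0 : 0 ≤ δ := angle_nonneg _ _
  set ψ := (α + β + δ) / 2 with hψ
  set h := r * Real.cos ψ with hh
  have c0 : 0 < Real.cos ψ := Real.cos_pos_of_mem_Ioo ⟨by linarith, by linarith⟩
  have h0 : 0 < h := mul_pos hr c0
  have key : ∀ φ, -ψ ≤ φ → φ ≤ ψ → Real.cos ψ ≤ Real.cos φ := by
    intro φ k1 k2
    rw [← Real.cos_abs φ]
    exact Real.cos_le_cos_of_nonneg_of_le_pi (abs_nonneg _) (by linarith) (abs_le.2 ⟨k1, k2⟩)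
  have n1 : 0 < ‖e₁‖ := norm_pos_iff.2 he₁
  have n2 : 0 < ‖e₂‖ := norm_pos_iff.2 he₂
  have k1 := key (-ψ + α) (by linarith) (by linarith)
  have k2 := key (-ψ + α + β) (by linarith) (by linarith)
  have d1 := norm_sub_of_angle_eq he₀ he₁ h0.le (φ₁ := -ψ) (φ₂ := -ψ + α) (by rw [← hα]; ring)
    (by linarith) (by linarith) (by linarith)
  have d2 := norm_sub_of_angle_eq he₁ he₂ h0.le (φ₁ := -ψ + α) (φ₂ := -ψ + α + β)
    (by rw [← hβ]; ring) (by linarith) (by linarith) (by linarith)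
  have d3 := norm_sub_of_angle_eq he₂ he₃ h0.le (φ₁ := -ψ + α + β) (φ₂ := ψ)
    (by rw [← hδ]; linarith) (by linarith) (by linarith) (by linarith)
  have r0 : h / Real.cos (-ψ) / ‖e₀‖ = 1 := by
    rw [Real.cos_neg, hh, h₀]; field_simp
  have r3 : h / Real.cos ψ / ‖e₃‖ = 1 := by
    rw [hh, h₃]; field_simp
  rw [r0, one_smul] at d1
  rw [r3, one_smul] at d3
  have q1 := c0.trans_le k1
  have q2 := c0.trans_le k2
  refine ⟨h / Real.cos (-ψ + α) / ‖e₁‖, h / Real.cos (-ψ + α + β) / ‖e₂‖, by positivity,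
    by positivity, ?_, ?_, ?_⟩
  · rw [div_mul_cancel₀ _ n1.ne', div_le_iff₀ q1]
    exact mul_le_mul_of_nonneg_left k1 hr.le
  · rw [div_mul_cancel₀ _ n2.ne', div_le_iff₀ q2]
    exact mul_le_mul_of_nonneg_left k2 hr.le
  · rw [d1, d2, d3]
    have : h * Real.tan ψ = r * Real.sin ψ := by
      rw [Real.tan_eq_sin_div_cos, hh]; field_simp
    have hs : Real.sin ψ < 1 := by
      have := Real.sin_lt_sin_of_lt_of_le_pi_div_two (x := ψ) (y := Real.pi / 2) (by linarith) le_rfl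
        (by linarith)
      rwa [Real.sin_pi_div_two] at this
    rw [Real.tan_neg]
    nlinarith

/-- First variation: two points at the same distance from a point and a line through it. -/
lemma exists_dist_add_dist_lt {x y d : W} {r : ℝ} (hx : ‖x‖ = r) (hy : ‖y‖ = r)
    (hr : 0 < r) (hk : inner ℝ x d + inner ℝ y d ≠ 0) {η : ℝ} (hη : 0 < η) :
    ∃ δ : ℝ, |δ| < η ∧ ‖x - δ • d‖ + ‖δ • d - y‖ < 2 * r := by
  set κ := inner ℝ x d + inner ℝ y d with hκ
  have hκ2 : 0 < κ ^ 2 := by positivity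
  obtain ⟨ε, hε, h1, h2⟩ : ∃ ε : ℝ, 0 < ε ∧ ε * |κ| < η ∧ ε * ‖d‖ ^ 2 < 1 := by
    refine ⟨min (η / (2 * |κ|)) (1 / (2 * (‖d‖ ^ 2 + 1))), by positivity, ?_, ?_⟩
    · calc _ ≤ η / (2 * |κ|) * |κ| := by gcongr; exact min_le_left _ _
        _ = η / 2 := by field_simp
        _ < η := by linarith
    · calc _ ≤ 1 / (2 * (‖d‖ ^ 2 + 1)) * ‖d‖ ^ 2 := by gcongr; exact min_le_right _ _
        _ < 1 := by rw [div_mul_eq_mul_div, div_lt_one (by positivity)]; nlinarith [sq_nonneg ‖d‖]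
  refine ⟨ε * κ, by rwa [abs_mul, abs_of_pos hε], ?_⟩
  have e1 : ‖x - (ε * κ) • d‖ ^ 2 = r ^ 2 - 2 * (ε * κ) * inner ℝ x d + (ε * κ) ^ 2 * ‖d‖ ^ 2 := by
    rw [norm_sub_sq_real, real_inner_smul_right, hx, norm_smul, mul_pow, Real.norm_eq_abs, sq_abs]
    ring
  have e2 : ‖(ε * κ) • d - y‖ ^ 2 = r ^ 2 - 2 * (ε * κ) * inner ℝ y d + (ε * κ) ^ 2 * ‖d‖ ^ 2 := by
    rw [norm_sub_rev, norm_sub_sq_real, real_inner_smul_right, hy, norm_smul, mul_pow,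
      Real.norm_eq_abs, sq_abs]
    ring
  have e3 : ‖x - (ε * κ) • d‖ ^ 2 + ‖(ε * κ) • d - y‖ ^ 2 < 2 * r ^ 2 := by
    have : ‖x - (ε * κ) • d‖ ^ 2 + ‖(ε * κ) • d - y‖ ^ 2 =
        2 * r ^ 2 - 2 * ε * κ ^ 2 * (1 - ε * ‖d‖ ^ 2) := by rw [e1, e2]; ring
    rw [this]
    have : 0 < 2 * ε * κ ^ 2 * (1 - ε * ‖d‖ ^ 2) := by
      have := sub_pos.2 h2
      positivity
    linarith
  by_contra! hcon
  nlinarith [sq_nonneg (‖x - (ε * κ) • d‖ - ‖(ε * κ) • d - y‖), norm_nonneg (x - (ε * κ) • d),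
    norm_nonneg ((ε * κ) • d - y)]

end RayPath

section Coord

lemma univ_eq_four : ∀ x w p q : Fin 4, x ≠ w → x ≠ p → x ≠ q → w ≠ p → w ≠ q → p ≠ q →
    (Finset.univ : Finset (Fin 4)) = {x, w, p, q} := by decide

lemma sum_eq_four {M : Type*} [AddCommMonoid M] {x w p q : Fin 4} (hxw : x ≠ w) (hxp : x ≠ p)
    (hxq : x ≠ q) (hwp : w ≠ p) (hwq : w ≠ q) (hpq : p ≠ q) (f : Fin 4 → M) :
    ∑ i, f i = f x + f w + f p + f q := by
  rw [univ_eq_four x w p q hxw hxp hxq hwp hwq hpq, Finset.sum_insert (by simp [*]),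
    Finset.sum_insert (by simp [*]), Finset.sum_insert (by simp [*]), Finset.sum_singleton]
  simp only [add_assoc]

variable {W : Type*} [NormedAddCommGroup W] [InnerProductSpace ℝ W] (b : AffineBasis (Fin 4) ℝ W)

lemma sum_coord_eq {x w p q : Fin 4} (hxw : x ≠ w) (hxp : x ≠ p)
    (hxq : x ≠ q) (hwp : w ≠ p) (hwq : w ≠ q) (hpq : p ≠ q) (P : W) :
    b.coord x P + b.coord w P + b.coord p P + b.coord q P = 1 := by
  rw [← sum_eq_four hxw hxp hxq hwp hwq hpq (fun i => b.coord i P)]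
  exact b.sum_coord_apply_eq_one P

lemma sub_vertex_eq {x w p q : Fin 4} (hxw : x ≠ w) (hxp : x ≠ p)
    (hxq : x ≠ q) (hwp : w ≠ p) (hwq : w ≠ q) (hpq : p ≠ q) {P : W} (hP : b.coord w P = 0) :
    P - b x = b.coord p P • (b p - b x) + b.coord q P • (b q - b x) := by
  have h1 := b.linear_combination_coord_eq_self P
  rw [sum_eq_four hxw hxp hxq hwp hwq hpq, hP, zero_smul, add_zero] at h1
  have h2 := sum_coord_eq b hxw hxp hxq hwp hwq hpq P
  rw [hP, add_zero] at h2
  have h3 : b.coord x P = 1 - b.coord p P - b.coord q P := by linarith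
  nth_rewrite 1 [← h1]
  rw [h3]
  module

lemma coord_le_one {P : W} (hP : ∀ w, 0 ≤ b.coord w P) (x : Fin 4) : b.coord x P ≤ 1 := by
  rw [← b.sum_coord_apply_eq_one P]
  exact Finset.single_le_sum (f := fun i => b.coord i P) (fun i _ => hP i) (Finset.mem_univ x)

lemma eq_of_coord_eq {P Q : W} (h : ∀ w, b.coord w P = b.coord w Q) : P = Q := by
  rw [← b.linear_combination_coord_eq_self P, ← b.linear_combination_coord_eq_self Q]
  simp [h]

lemma eq_vertex_of_coord_eq_one {P : W} (hP : ∀ w, 0 ≤ b.coord w P) {x : Fin 4}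
    (h : b.coord x P = 1) : P = b x := by
  have hz : ∀ w, w ≠ x → b.coord w P = 0 := by
    intro w hw
    have h1 := b.sum_coord_apply_eq_one P
    have h2 := Finset.add_le_sum (f := fun i => b.coord i P) (fun i _ => hP i) (Finset.mem_univ x)
      (Finset.mem_univ w) hw.symm
    have := hP w
    simp only [h1, h] at h2
    linarith
  apply eq_of_coord_eq b
  intro w
  by_cases hw : w = x
  · subst hw; rw [h, b.coord_apply_eq]
  · rw [hz w hw, b.coord_apply_ne hw]

/-- Additivity of the angle at a vertex of a face. -/
lemma angle_add_angle_vertex {x w p q : Fin 4} (hxw : x ≠ w) (hxp : x ≠ p)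
    (hxq : x ≠ q) (hwp : w ≠ p) (hwq : w ≠ q) (hpq : p ≠ q) {P : W} (hP : b.coord w P = 0)
    (hP0 : ∀ w, 0 ≤ b.coord w P) (hne : P ≠ b x) :
    angle (b p - b x) (b q - b x) = angle (b p - b x) (P - b x) + angle (P - b x) (b q - b x) := by
  apply angle_eq_angle_add_add_angle_add_of_mem_span (sub_ne_zero.2 hne)
  rw [Submodule.mem_span_pair]
  exact ⟨⟨_, hP0 p⟩, ⟨_, hP0 q⟩, (sub_vertex_eq b hxw hxp hxq hwp hwq hpq hP).symm⟩

end Coord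

end TetraGeodesic

namespace TetraGeodesic

open Set InnerProductGeometry

/-- An injective arc on the surface of a tetrahedron, no longer than polygonal lines
with three edges which are contained in faces. -/
structure IsShortOn (b : AffineBasis (Fin 4) ℝ (EuclideanSpace ℝ (Fin 3)))
    (γ : ℝ → EuclideanSpace ℝ (Fin 3)) (u v : ℝ) : Prop where
  cont : Continuous γ
  injOn : InjOn γ (Ioo u v)
  nonneg : ∀ t w, 0 ≤ b.coord w (γ t)
  exists_zero : ∀ t, ∃ w, b.coord w (γ t) = 0
  short : ∀ s₁ s s₂, u < s₁ → s₁ ≤ s → s ≤ s₂ → s₂ < v →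
    ∀ p q, SameFace b (γ s₁) p → SameFace b p q → SameFace b q (γ s₂) →
    dist (γ s₁) (γ s) + dist (γ s) (γ s₂) ≤ dist (γ s₁) p + dist p q + dist q (γ s₂)

variable {b : AffineBasis (Fin 4) ℝ (EuclideanSpace ℝ (Fin 3))}
  {γ : ℝ → EuclideanSpace ℝ (Fin 3)} {u v : ℝ}

lemma LocallyShortest.eq_iff (h : LocallyShortest b γ) (s t : ℝ) :
    γ s = γ t ↔ Int.fract s = Int.fract t := by
  have hf : ∀ s, γ (Int.fract s) = γ s := fun s => by
    have := h.periodic.sub_int_mul_eq (x := s) ⌊s⌋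
    rwa [mul_one, Int.self_sub_floor] at this
  constructor
  · intro hst
    apply h.injOn ⟨Int.fract_nonneg _, Int.fract_lt_one _⟩ ⟨Int.fract_nonneg _, Int.fract_lt_one _⟩
    rw [hf, hf, hst]
  · intro hst
    rw [← hf, hst, hf]

lemma LocallyShortest.eq_of_eq (h : LocallyShortest b γ) {s t : ℝ} (hst : γ s = γ t)
    (hd : |s - t| < 1) : s = t := by
  obtain ⟨z, hz⟩ := Int.fract_eq_fract.1 ((h.eq_iff s t).1 hst)
  rw [hz] at hd
  have hz0 : z = 0 := by
    have : |z| < 1 := by exact_mod_cast hd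
    exact Int.abs_lt_one_iff.1 this
  rw [hz0] at hz
  simp at hz
  linarith

lemma LocallyShortest.exists_isShortOn (h : LocallyShortest b γ) (t : ℝ) :
    ∃ ε > 0, IsShortOn b γ (t - ε) (t + ε) := by
  obtain ⟨ε, hε, H⟩ := h.short t
  have m1 := min_le_left ε (1 / 2)
  have m2 := min_le_right ε (1 / 2)
  refine ⟨min ε (1 / 2), by positivity, h.cont, fun s hs s' hs' he => h.eq_of_eq he ?_, h.nonneg,
    h.exists_zero, fun s₁ s s₂ h1 h2 h3 h4 => H s₁ s s₂ (by linarith) h2 h3 (by linarith)⟩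
  rw [abs_lt]
  constructor <;> linarith [hs.1, hs.2, hs'.1, hs'.2]

lemma IsShortOn.mono (h : IsShortOn b γ u v) {u' v' : ℝ} (hu : u ≤ u') (hv : v' ≤ v) :
    IsShortOn b γ u' v' :=
  ⟨h.cont, h.injOn.mono (Ioo_subset_Ioo hu hv), h.nonneg, h.exists_zero,
    fun s₁ s s₂ h1 h2 h3 h4 => h.short s₁ s s₂ (by linarith) h2 h3 (by linarith)⟩

lemma IsShortOn.wbtw (h : IsShortOn b γ u v) {s₁ s s₂ : ℝ} (h1 : u < s₁) (h2 : s₁ ≤ s) (h3 : s ≤ s₂)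
    (h4 : s₂ < v) {w : Fin 4} (hw₁ : b.coord w (γ s₁) = 0) (hw₂ : b.coord w (γ s₂) = 0) :
    Wbtw ℝ (γ s₁) (γ s) (γ s₂) := by
  rw [← dist_add_dist_eq_iff]
  refine le_antisymm ?_ (dist_triangle _ _ _)
  have hs : SameFace b (γ s₁) (γ s₁) := ⟨h.nonneg _, h.nonneg _, w, hw₁, hw₁⟩
  have := h.short s₁ s s₂ h1 h2 h3 h4 _ _ hs hs ⟨h.nonneg _, h.nonneg _, w, hw₁, hw₂⟩
  simpa using this

lemma IsShortOn.sbtw (h : IsShortOn b γ u v) {s₁ s s₂ : ℝ} (h1 : u < s₁) (h2 : s₁ < s) (h3 : s < s₂)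
    (h4 : s₂ < v) {w : Fin 4} (hw₁ : b.coord w (γ s₁) = 0) (hw₂ : b.coord w (γ s₂) = 0) :
    Sbtw ℝ (γ s₁) (γ s) (γ s₂) := by
  refine ⟨h.wbtw h1 h2.le h3.le h4 hw₁ hw₂, fun he => ?_, fun he => ?_⟩
  · exact h2.ne' (h.injOn ⟨by linarith, by linarith⟩ ⟨by linarith, by linarith⟩ he)
  · exact h3.ne (h.injOn ⟨by linarith, by linarith⟩ ⟨by linarith, by linarith⟩ he)

lemma coord_eq_zero_of_wbtw {w : Fin 4} {P Q R : EuclideanSpace ℝ (Fin 3)} (h : Wbtw ℝ P Q R)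
    (h1 : b.coord w P = 0) (h2 : b.coord w R = 0) : b.coord w Q = 0 := by
  obtain ⟨k, -, rfl⟩ := h
  rw [AffineMap.apply_lineMap, h1, h2]
  simp

lemma continuous_coord_comp (hγ : Continuous γ) (w : Fin 4) :
    Continuous fun t => b.coord w (γ t) :=
  (b.coord w).continuous_of_finiteDimensional.comp hγ

lemma coord_lineMap_nonneg {P Q : EuclideanSpace ℝ (Fin 3)} (hP : ∀ w, 0 ≤ b.coord w P)
    (hQ : ∀ w, 0 ≤ b.coord w Q) {σ : ℝ} (h0 : 0 ≤ σ) (h1 : σ ≤ 1) (w : Fin 4) :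
    0 ≤ b.coord w (AffineMap.lineMap P Q σ) := by
  rw [AffineMap.apply_lineMap, AffineMap.lineMap_apply_ring]
  have := mul_nonneg h0 (hQ w)
  have := mul_nonneg (sub_nonneg.2 h1) (hP w)
  linarith

lemma coord_vertex_nonneg (x w : Fin 4) : 0 ≤ b.coord w (b x) := by
  classical
  rw [b.coord_apply]; split_ifs <;> norm_num

lemma coord_lineMap_eq_zero {x p w : Fin 4} (hx : w ≠ x) (hp : w ≠ p) (σ : ℝ) :
    b.coord w (AffineMap.lineMap (b x) (b p) σ) = 0 := by
  rw [AffineMap.apply_lineMap, b.coord_apply_ne hx, b.coord_apply_ne hp]; simp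

lemma exists_pos_le_norm_sub (x : Fin 4) : ∃ m > 0, ∀ y ≠ x, m ≤ ‖b y - b x‖ := by
  obtain ⟨y, hy, h⟩ := (Finset.univ.filter (fun y : Fin 4 => y ≠ x)).exists_min_image
    (fun y => ‖b y - b x‖) ⟨x + 1, by simp⟩
  refine ⟨‖b y - b x‖, ?_, fun z hz => h z (by simpa using hz)⟩
  rw [gt_iff_lt, norm_pos_iff, sub_ne_zero]
  exact fun he => by simp at hy; exact hy (b.ind.injective he)

lemma IsShortOn.pi_le_of_path (h : IsShortOn b γ u v) {s₁ t s₂ r : ℝ} (h1 : u < s₁) (h2 : s₁ ≤ t)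
    (h3 : t ≤ s₂) (h4 : s₂ < v) {x : Fin 4} (hx : γ t = b x) (hr : 0 < r)
    (hr₁ : ‖γ s₁ - b x‖ = r) (hr₂ : ‖γ s₂ - b x‖ = r) (hrm : ∀ y ≠ x, r ≤ ‖b y - b x‖)
    {w₁ w₂ p q k : Fin 4} (hw₁ : b.coord w₁ (γ s₁) = 0) (hw₂ : b.coord w₂ (γ s₂) = 0)
    (hw₁x : w₁ ≠ x) (hw₂x : w₂ ≠ x) (hkx : k ≠ x) (hpx : p ≠ x) (hqx : q ≠ x)
    (hw₁p : w₁ ≠ p) (hkp : k ≠ p) (hkq : k ≠ q) (hw₂q : w₂ ≠ q) :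
    Real.pi ≤ angle (γ s₁ - b x) (b p - b x) + angle (b p - b x) (b q - b x) +
      angle (b q - b x) (γ s₂ - b x) := by
  by_contra! hlt
  obtain ⟨σ₁, σ₂, a1, a2, a3, a4, a5⟩ := exists_ray_path
    (by rw [← norm_pos_iff, hr₁]; exact hr)
    (by rw [← norm_pos_iff]; exact hr.trans_le (hrm p hpx))
    (by rw [← norm_pos_iff]; exact hr.trans_le (hrm q hqx)) hr₁ hr₂ hlt
  have b1 : σ₁ ≤ 1 := by
    have := hrm p hpx
    by_contra! hc
    nlinarith
  have b2 : σ₂ ≤ 1 := by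
    have := hrm q hqx
    by_contra! hc
    nlinarith
  have c1 : ∀ w, 0 ≤ b.coord w (AffineMap.lineMap (b x) (b p) σ₁) :=
    coord_lineMap_nonneg (coord_vertex_nonneg x) (coord_vertex_nonneg p) a1 b1
  have c2 : ∀ w, 0 ≤ b.coord w (AffineMap.lineMap (b x) (b q) σ₂) :=
    coord_lineMap_nonneg (coord_vertex_nonneg x) (coord_vertex_nonneg q) a2 b2
  have := h.short s₁ t s₂ h1 h2 h3 h4 (AffineMap.lineMap (b x) (b p) σ₁)
    (AffineMap.lineMap (b x) (b q) σ₂)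
    ⟨h.nonneg _, c1, w₁, hw₁, coord_lineMap_eq_zero hw₁x hw₁p _⟩
    ⟨c1, c2, k, coord_lineMap_eq_zero hkx hkp _, coord_lineMap_eq_zero hkx hkq _⟩
    ⟨c2, h.nonneg _, w₂, coord_lineMap_eq_zero hw₂x hw₂q _, hw₂⟩
  rw [hx, dist_comm (b x), dist_eq_norm, dist_eq_norm, dist_eq_norm, dist_eq_norm, dist_eq_norm,
    hr₁, hr₂] at this
  simp only [AffineMap.lineMap_apply, vsub_eq_sub, vadd_eq_add] at this
  rw [sub_add_eq_sub_sub_swap, add_sub_add_right_eq_sub, add_sub_assoc _ (b x),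
    ← neg_sub (γ s₂) (b x), ← sub_eq_add_neg] at this
  linarith

/-- The sum of the three face angles at a vertex is less than `2 * π`. -/
def PositiveCurvature (b : AffineBasis (Fin 4) ℝ (EuclideanSpace ℝ (Fin 3))) : Prop :=
  ∀ x p q r : Fin 4, x ≠ p → x ≠ q → x ≠ r → p ≠ q → p ≠ r → q ≠ r →
    angle (b p - b x) (b q - b x) + angle (b q - b x) (b r - b x) +
      angle (b r - b x) (b p - b x) < 2 * Real.pi

lemma IsShortOn.ne_vertex (h : IsShortOn b γ u v) (hb : PositiveCurvature b) {t : ℝ} (h1 : u < t)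
    (h2 : t < v) (x : Fin 4) : γ t ≠ b x := by
  intro hx
  have hev : ∀ᶠ s in nhds t, 0 < b.coord x (γ s) := by
    refine (continuous_coord_comp h.cont x).continuousAt.eventually_const_lt ?_
    simp only [hx, b.coord_apply_eq]; norm_num
  obtain ⟨δ₀, hδ₀, hd⟩ := Metric.eventually_nhds_iff.1 hev
  obtain ⟨δ, hδ, e1, e2, e3⟩ : ∃ δ > 0, δ < δ₀ ∧ u < t - δ ∧ t + δ < v := by
    refine ⟨min (δ₀ / 2) (min ((t - u) / 2) ((v - t) / 2)), ?_, ?_, ?_, ?_⟩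
    · have := sub_pos.2 h1
      have := sub_pos.2 h2
      positivity
    · have := min_le_left (δ₀ / 2) (min ((t - u) / 2) ((v - t) / 2)); linarith
    · have := (min_le_right (δ₀ / 2) _).trans (min_le_left ((t - u) / 2) ((v - t) / 2)); linarith
    · have := (min_le_right (δ₀ / 2) _).trans (min_le_right ((t - u) / 2) ((v - t) / 2)); linarith
  obtain ⟨m, hm, hmle⟩ := exists_pos_le_norm_sub (b := b) x
  have hne : ∀ s, u < s → s < v → s ≠ t → 0 < dist (γ s) (b x) := by
    intro s hs hs' hst
    rw [dist_pos, ← hx]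
    exact fun he => hst (h.injOn ⟨hs, hs'⟩ ⟨h1, h2⟩ he)
  have hd1 := hne (t - δ) (by linarith) (by linarith) (by linarith)
  have hd2 := hne (t + δ) (by linarith) (by linarith) (by linarith)
  obtain ⟨r, hr, r1, r2, r3⟩ : ∃ r > 0, r ≤ dist (γ (t - δ)) (b x) ∧ r ≤ dist (γ (t + δ)) (b x) ∧
      r ≤ m :=
    ⟨min m (min (dist (γ (t - δ)) (b x)) (dist (γ (t + δ)) (b x))), by positivity,
      (min_le_right _ _).trans (min_le_left _ _), (min_le_right _ _).trans (min_le_right _ _),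
      min_le_left _ _⟩
  have hcont : Continuous fun s => dist (γ s) (b x) := h.cont.dist continuous_const
  obtain ⟨s₁, hs₁, hr₁⟩ := intermediate_value_Icc' (by linarith : t - δ ≤ t) hcont.continuousOn
    (show r ∈ Icc (dist (γ t) (b x)) (dist (γ (t - δ)) (b x)) from ⟨by rw [hx, dist_self]; exact hr.le, r1⟩)
  obtain ⟨s₂, hs₂, hr₂⟩ := intermediate_value_Icc (by linarith : t ≤ t + δ) hcont.continuousOn
    (show r ∈ Icc (dist (γ t) (b x)) (dist (γ (t + δ)) (b x)) from ⟨by rw [hx, dist_self]; exact hr.le, r2⟩)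
  simp only [dist_eq_norm] at hr₁ hr₂
  have p1 : 0 < b.coord x (γ s₁) := hd (by rw [Real.dist_eq, abs_lt]; constructor <;> linarith [hs₁.1, hs₁.2])
  have p2 : 0 < b.coord x (γ s₂) := hd (by rw [Real.dist_eq, abs_lt]; constructor <;> linarith [hs₂.1, hs₂.2])
  obtain ⟨w₁, hw₁⟩ := h.exists_zero s₁
  obtain ⟨w₂, hw₂⟩ := h.exists_zero s₂
  have hw₁x : w₁ ≠ x := by rintro rfl; linarith
  have hw₂x : w₂ ≠ x := by rintro rfl; linarith
  have hn₁ : γ s₁ ≠ b x := by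
    intro he; rw [he, sub_self, norm_zero] at hr₁; linarith
  have hn₂ : γ s₂ ≠ b x := by
    intro he; rw [he, sub_self, norm_zero] at hr₂; linarith
  have hu1 : u < s₁ := by linarith [hs₁.1]
  have hv2 : s₂ < v := by linarith [hs₂.2]
  by_cases hww : w₁ = w₂
  · subst hww
    obtain ⟨k, ⟨hk0, hk1⟩, hk⟩ := h.wbtw hu1 hs₁.2 hs₂.1 hv2 hw₁ hw₂
    have hlt : ∀ s, γ s ≠ b x → b.coord x (γ s) < 1 := fun s hs =>
      lt_of_le_of_ne (coord_le_one b (h.nonneg s) x)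
        fun he => hs (eq_vertex_of_coord_eq_one b (h.nonneg s) he)
    have := congrArg (b.coord x) hk
    rw [hx, b.coord_apply_eq, AffineMap.apply_lineMap, AffineMap.lineMap_apply_ring] at this
    have l1 := hlt s₁ hn₁
    have l2 := hlt s₂ hn₂
    rcases hk0.eq_or_lt with rfl | hk0
    · linarith
    · have := mul_nonneg (sub_nonneg.2 hk1) (sub_nonneg.2 l1.le)
      have := mul_pos hk0 (sub_pos.2 l2)
      linarith
  · obtain ⟨f1, f2, f3⟩ := fourth_ne x w₁ w₂ hw₁x.symm hw₂x.symm hww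
    set y := fourth x w₁ w₂
    have hrm : ∀ z ≠ x, r ≤ ‖b z - b x‖ := fun z hz => r3.trans (hmle z hz)
    have A1 := angle_add_angle_vertex b hw₁x.symm hw₂x.symm f1.symm hww f2.symm f3.symm hw₁
      (h.nonneg _) hn₁
    have A2 := angle_add_angle_vertex b hw₂x.symm hw₁x.symm f1.symm (Ne.symm hww) f3.symm f2.symm
      hw₂ (h.nonneg _) hn₂
    have B1 := h.pi_le_of_path hu1 hs₁.2 hs₂.1 hv2 hx hr hr₁ hr₂ hrm hw₁ hw₂ hw₁x hw₂x
      (p := y) (q := y) (k := w₁) hw₁x f1 f1 f2.symm f2.symm f2.symm f3.symm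
    have B2 := h.pi_le_of_path hu1 hs₁.2 hs₂.1 hv2 hx hr hr₁ hr₂ hrm hw₁ hw₂ hw₁x hw₂x
      (p := w₂) (q := w₁) (k := y) f1 hw₂x hw₁x hww f3 f2 (Ne.symm hww)
    have C := hb x w₁ w₂ y hw₁x.symm hw₂x.symm f1.symm hww f2.symm f3.symm
    have hy0 : b y - b x ≠ 0 := by
      rw [← norm_pos_iff]; exact hr.trans_le (hrm y f1)
    rw [angle_self hy0, add_zero] at B1
    rw [angle_comm (γ s₁ - b x) (b w₂ - b x)] at B2
    rw [angle_comm (b y - b x) (γ s₂ - b x)] at B1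
    rw [angle_comm (b y - b x) (b w₁ - b x)] at C
    rw [angle_comm (b w₂ - b x) (b w₁ - b x)] at B2
    linarith

end TetraGeodesic

namespace TetraGeodesic

open Set InnerProductGeometry Filter Topology

/-- Enumeration of a closed discrete periodic set of real numbers. -/
lemma exists_enumeration {T : Set ℝ} (hc : IsClosed T) (hd : ∀ t, ∀ᶠ s in 𝓝[≠] t, s ∉ T)
    (hp : ∀ t, t + 1 ∈ T ↔ t ∈ T) (hne : T.Nonempty) :
    ∃ (n : ℕ) (t : ℕ → ℝ), n ≠ 0 ∧ StrictMono t ∧ (∀ k, t (k + n) = t k + 1) ∧ (∀ k, t k ∈ T) ∧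
      ∀ k s, t k < s → s < t (k + 1) → s ∉ T := by
  have hnext : ∀ t, ∃ t', t ∈ T → t' ∈ T ∧ t < t' ∧ ∀ s ∈ T, t < s → t' ≤ s := by
    intro t
    by_cases ht : t ∈ T
    · obtain ⟨ε, hε, H⟩ := Metric.eventually_nhds_iff.1 (eventually_nhdsWithin_iff.1 (hd t))
      have hS : IsClosed (T ∩ Ici (t + ε)) := hc.inter isClosed_Ici
      have hsub : ∀ s ∈ T, t < s → s ∈ T ∩ Ici (t + ε) := by
        intro s hs hts
        refine ⟨hs, ?_⟩
        by_contra hlt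
        simp only [mem_Ici, not_le] at hlt
        exact H (by rw [Real.dist_eq, abs_lt]; constructor <;> linarith) (ne_of_gt hts) hs
      have hbb : BddBelow (T ∩ Ici (t + ε)) := ⟨t + ε, fun s hs => hs.2⟩
      have hmem := hS.csInf_mem ⟨t + 1, hsub _ ((hp t).2 ht) (by linarith)⟩ hbb
      refine ⟨sInf (T ∩ Ici (t + ε)), fun _ => ⟨hmem.1, ?_, fun s hs hts =>
        csInf_le hbb (hsub s hs hts)⟩⟩
      have := hmem.2
      simp only [mem_Ici] at this
      linarith
    · exact ⟨0, fun h => absurd h ht⟩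
  choose nxt hnxt using hnext
  obtain ⟨τ, hτ⟩ := hne
  let t : ℕ → ℝ := fun k => nxt^[k] τ
  have tsucc : ∀ k, t (k + 1) = nxt (t k) := fun k => Function.iterate_succ_apply' nxt k τ
  have tT : ∀ k, t k ∈ T := by
    intro k
    induction k with
    | zero => exact hτ
    | succ k ih => rw [tsucc]; exact (hnxt _ ih).1
  have tmono : StrictMono t := strictMono_nat_of_lt_succ fun k => by
    rw [tsucc]; exact (hnxt _ (tT k)).2.1
  have tle : ∀ k s, s ∈ T → t k < s → t (k + 1) ≤ s := fun k s hs hks => by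
    rw [tsucc]; exact (hnxt _ (tT k)).2.2 s hs hks
  have tgap : ∀ k s, t k < s → s < t (k + 1) → s ∉ T := fun k s h1 h2 hs =>
    absurd (tle k s hs h1) (not_le.2 h2)
  have hstep : ∀ s ∈ T, nxt (s + 1) = nxt s + 1 := by
    intro s hs
    obtain ⟨a1, a2, a3⟩ := hnxt s hs
    obtain ⟨b1, b2, b3⟩ := hnxt (s + 1) ((hp s).2 hs)
    refine le_antisymm (b3 _ ((hp _).2 a1) (by linarith)) ?_
    have : nxt (s + 1) - 1 ∈ T := by rw [← hp]; simpa using b1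
    linarith [a3 _ this (by linarith)]
  have hex : ∃ n, t n = τ + 1 := by
    by_contra! hno
    have hlt : ∀ k, t k < τ + 1 := by
      intro k
      induction k with
      | zero => exact lt_add_one τ
      | succ k ih => exact lt_of_le_of_ne (tle k _ ((hp τ).2 hτ) ih) (hno _)
    have hbdd : BddAbove (range t) := ⟨τ + 1, by rintro _ ⟨k, rfl⟩; exact (hlt k).le⟩
    have htend := tendsto_atTop_ciSup tmono.monotone hbdd
    have hne' : ∀ k, t k ≠ ⨆ k, t k := fun k =>
      ((tmono (Nat.lt_succ_self k)).trans_le (le_ciSup hbdd (k + 1))).ne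
    have := (tendsto_nhdsWithin_iff.2 ⟨htend, Eventually.of_forall hne'⟩).eventually (hd _)
    obtain ⟨k, hk⟩ := this.exists
    exact hk (tT k)
  obtain ⟨n, hn⟩ := hex
  refine ⟨n, t, ?_, tmono, fun k => ?_, tT, tgap⟩
  · rintro rfl
    have : t 0 = τ := rfl
    linarith
  · induction k with
    | zero => rw [zero_add, hn]; rfl
    | succ k ih => rw [add_right_comm, tsucc, ih, hstep _ (tT k), tsucc]

variable {b : AffineBasis (Fin 4) ℝ (EuclideanSpace ℝ (Fin 3))}
  {γ : ℝ → EuclideanSpace ℝ (Fin 3)} {u v : ℝ}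

lemma exists_face_of_isPreconnected (hγ : Continuous γ) (hz : ∀ t, ∃ w, b.coord w (γ t) = 0)
    {S : Set ℝ} (hS : IsPreconnected S)
    (hT : ∀ s ∈ S, ∀ w w', b.coord w (γ s) = 0 → b.coord w' (γ s) = 0 → w = w') :
    ∃ w, ∀ s ∈ S, b.coord w (γ s) = 0 := by
  rcases S.eq_empty_or_nonempty with rfl | ⟨s₀, hs₀⟩
  · simp
  obtain ⟨w, hw⟩ := hz s₀
  refine ⟨w, ?_⟩
  by_contra! hcon
  obtain ⟨s, hs, hsw⟩ := hcon
  have hcl : ∀ w, IsClosed {t | b.coord w (γ t) = 0} := fun w =>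
    isClosed_eq (continuous_coord_comp hγ w) continuous_const
  have hcl' : IsClosed (⋃ w' ∈ {w' | w' ≠ w}, {t | b.coord w' (γ t) = 0}) :=
    (Set.toFinite {w' | w' ≠ w}).isClosed_biUnion fun w' _ => hcl w'
  obtain ⟨r, hr, hr1, hr2⟩ := isPreconnected_closed_iff.1 hS _ _ (hcl w) hcl' (by
    intro r hr
    obtain ⟨w', hw'⟩ := hz r
    by_cases he : w' = w
    · left; rw [← he]; exact hw'
    · right; exact mem_biUnion (show w' ∈ {w' | w' ≠ w} from he) hw') ⟨s₀, hs₀, hw⟩ (by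
    obtain ⟨w', hw'⟩ := hz s
    refine ⟨s, hs, mem_biUnion (show w' ∈ {w' | w' ≠ w} from ?_) hw'⟩
    rintro rfl; exact hsw hw')
  simp only [mem_iUnion] at hr2
  obtain ⟨w', hw', h⟩ := hr2
  exact hw' (hT r hr w' w h hr1)

/-- A linear function along a geodesic in a face has no interior maximum, unless constant. -/
lemma LocallyShortest.max_principle (h : LocallyShortest b γ) {w : Fin 4} {a c : ℝ}
    (hw : ∀ s ∈ Icc a c, b.coord w (γ s) = 0) (l : EuclideanSpace ℝ (Fin 3) →L[ℝ] ℝ) {t₀ : ℝ}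
    (ht₀ : t₀ ∈ Ioo a c) (hmax : ∀ s ∈ Icc a c, l (γ s) ≤ l (γ t₀)) :
    ∀ s ∈ Icc a c, l (γ s) = l (γ t₀) := by
  set M := l (γ t₀)
  have hlc : Continuous fun s => l (γ s) := l.continuous.comp h.cont
  have hopen : ∀ s ∈ Ioo a c, l (γ s) = M → ∀ᶠ s' in 𝓝 s, l (γ s') = M := by
    intro s hs hsM
    obtain ⟨ε, hε, H⟩ := h.exists_isShortOn s
    obtain ⟨δ, hδ, d1, d2, d3⟩ : ∃ δ > 0, δ ≤ ε ∧ a ≤ s - δ ∧ s + δ ≤ c := by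
      have := sub_pos.2 hs.1
      have := sub_pos.2 hs.2
      refine ⟨min ε (min (s - a) (c - s)), by positivity, min_le_left _ _, ?_, ?_⟩
      · linarith [(min_le_right ε _).trans (min_le_left (s - a) (c - s))]
      · linarith [(min_le_right ε _).trans (min_le_right (s - a) (c - s))]
    have key : ∀ s₁ s₂, s - δ < s₁ → s₁ < s → s < s₂ → s₂ < s + δ →
        l (γ s₁) = M ∧ l (γ s₂) = M := by
      intro s₁ s₂ h1 h2 h3 h4
      have m1 : s₁ ∈ Icc a c := ⟨by linarith, by linarith⟩
      have m2 : s₂ ∈ Icc a c := ⟨by linarith, by linarith⟩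
      have := H.sbtw (by linarith) h2 h3 (by linarith) (hw s₁ m1) (hw s₂ m2)
      obtain ⟨⟨k, ⟨hk0, hk1⟩, hk⟩, -⟩ := sbtw_iff_mem_image_Ioo_and_ne.1 this
      have e := congrArg l hk
      simp only [AffineMap.lineMap_apply, vsub_eq_sub, vadd_eq_add, map_add, map_smul, map_sub,
        smul_eq_mul, hsM] at e
      have l1 := hmax s₁ m1
      have l2 := hmax s₂ m2
      constructor <;> nlinarith
    refine Metric.eventually_nhds_iff.2 ⟨δ, hδ, fun s' hs' => ?_⟩
    rw [Real.dist_eq, abs_lt] at hs'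
    rcases lt_trichotomy s' s with hlt | rfl | hgt
    · exact (key s' (s + δ / 2) (by linarith) hlt (by linarith) (by linarith)).1
    · exact hsM
    · exact (key (s - δ / 2) s' (by linarith) (by linarith) hgt (by linarith)).2
  have hsub : Ioo a c ⊆ interior {s | l (γ s) = M} := by
    apply isPreconnected_Ioo.subset_left_of_subset_union isOpen_interior
      (isOpen_lt hlc continuous_const : IsOpen {s | l (γ s) < M})
    · rw [Set.disjoint_left]
      intro s hs hs'
      have hs'' : s ∈ {s | l (γ s) = M} := interior_subset hs
      exact (ne_of_lt (show l (γ s) < M from hs')) hs''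
    · intro s hs
      rcases (hmax s (Ioo_subset_Icc_self hs)).eq_or_lt with he | hlt
      · left; exact mem_interior_iff_mem_nhds.2 (hopen s hs he)
      · right; exact hlt
    · exact ⟨t₀, ht₀, mem_interior_iff_mem_nhds.2 (hopen t₀ ht₀ rfl)⟩
  have hcl : IsClosed {s | l (γ s) = M} := isClosed_eq hlc continuous_const
  intro s hs
  rw [← closure_Ioo (ht₀.1.trans ht₀.2).ne] at hs
  exact closure_minimal (hsub.trans interior_subset) hcl hs

lemma LocallyShortest.not_forall_coord_eq_zero (h : LocallyShortest b γ) (w : Fin 4) :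
    ¬ ∀ s, b.coord w (γ s) = 0 := by
  intro hw
  have hne : γ 0 ≠ γ (1 / 2) := fun he => by
    have := h.eq_of_eq he (by norm_num)
    norm_num at this
  set d := γ 0 - γ (1 / 2) with hd
  have hlc : Continuous fun s => innerSL ℝ d (γ s) := (innerSL ℝ d).continuous.comp h.cont
  obtain ⟨t₀, ht₀, hmax⟩ := isCompact_Icc.exists_isMaxOn (nonempty_Icc.2 zero_le_one)
    (hlc.continuousOn (s := Icc (0 : ℝ) 1))
  have hmax' : ∀ s, innerSL ℝ d (γ s) ≤ innerSL ℝ d (γ t₀) := by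
    intro s
    have : γ s = γ (Int.fract s) := (h.eq_iff _ _).2 (by simp)
    rw [this]
    exact hmax ⟨Int.fract_nonneg _, (Int.fract_lt_one _).le⟩
  have := h.max_principle (a := t₀ - 2) (c := t₀ + 2) (fun s _ => hw s) (innerSL ℝ d)
    ⟨by linarith, by linarith⟩ (fun s _ => hmax' s)
  have e1 := this 0 ⟨by linarith [ht₀.2], by linarith [ht₀.1]⟩
  have e2 := this (1 / 2) ⟨by linarith [ht₀.2], by linarith [ht₀.1]⟩
  have e3 : innerSL ℝ d d = 0 := by
    nth_rewrite 2 [hd]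
    rw [map_sub, e1, e2, sub_self]
  rw [innerSL_apply_apply, inner_self_eq_zero] at e3
  exact hne (sub_eq_zero.1 e3)

lemma LocallyShortest.wbtw_of_face (h : LocallyShortest b γ) {w : Fin 4} {a c : ℝ}
    (hw : ∀ s ∈ Icc a c, b.coord w (γ s) = 0) {s : ℝ} (hs : s ∈ Icc a c) :
    Wbtw ℝ (γ a) (γ s) (γ c) := by
  rw [← mem_segment_iff_wbtw]
  by_contra hcon
  have hcl : IsClosed (segment ℝ (γ a) (γ c)) := by
    rw [← convexHull_pair]
    exact (Set.toFinite _).isClosed_convexHull ℝ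
  obtain ⟨l, r, h1, h2⟩ := geometric_hahn_banach_closed_point (convex_segment _ _) hcl hcon
  have hlc : Continuous fun s => l (γ s) := l.continuous.comp h.cont
  obtain ⟨t₀, ht₀, hmax⟩ := isCompact_Icc.exists_isMaxOn ⟨s, hs⟩
    (hlc.continuousOn (s := Icc a c))
  have ha := h1 _ (left_mem_segment ℝ _ _)
  have hc := h1 _ (right_mem_segment ℝ (γ a) (γ c))
  have hst : l (γ s) ≤ l (γ t₀) := hmax hs
  have ht₀' : t₀ ∈ Ioo a c := by
    constructor
    · refine lt_of_le_of_ne ht₀.1 ?_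
      rintro rfl
      linarith
    · refine lt_of_le_of_ne ht₀.2 ?_
      rintro rfl
      linarith
  have := h.max_principle hw l ht₀' hmax a ⟨le_rfl, ht₀'.1.le.trans ht₀'.2.le⟩
  linarith

lemma LocallyShortest.exists_eq_of_wbtw (h : LocallyShortest b γ) {w : Fin 4} {a c : ℝ}
    (hac : a ≤ c) (hw : ∀ s ∈ Icc a c, b.coord w (γ s) = 0) {P : EuclideanSpace ℝ (Fin 3)}
    (hP : Wbtw ℝ (γ a) P (γ c)) : ∃ s ∈ Icc a c, γ s = P := by
  obtain ⟨k, ⟨hk0, hk1⟩, rfl⟩ := hP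
  by_cases hne : γ a = γ c
  · exact ⟨a, ⟨le_rfl, hac⟩, by rw [hne]; simp⟩
  set d := γ c - γ a with hd
  have hd0 : 0 < inner ℝ d d := by
    rw [real_inner_self_eq_norm_sq]
    have : 0 < ‖d‖ := norm_pos_iff.2 (sub_ne_zero.2 (Ne.symm hne))
    positivity
  have hlc : Continuous fun s => inner ℝ d (γ s - γ a) := continuous_const.inner (h.cont.sub continuous_const)
  obtain ⟨s, hs, hsk⟩ := intermediate_value_Icc hac hlc.continuousOn
    (show k * inner ℝ d d ∈ _ from ⟨by simp; positivity, by rw [← hd]; nlinarith⟩)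
  refine ⟨s, hs, ?_⟩
  obtain ⟨m, hm, hms⟩ := h.wbtw_of_face hw hs
  rw [← hms]
  simp only [← hms, AffineMap.lineMap_apply, vsub_eq_sub, vadd_eq_add, add_sub_cancel_right,
    ← hd, inner_smul_right] at hsk
  rw [mul_right_cancel₀ hd0.ne' hsk]

/-- The curve does not run along an edge. -/
lemma LocallyShortest.not_edge (h : LocallyShortest b γ) (hb : PositiveCurvature b)
    (hs : IsShortOn b γ u v) {s₁ s₂ : ℝ} (h1 : u < s₁) (h2 : s₁ < s₂) (h3 : s₂ < v) {w w' : Fin 4}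
    (hww : w ≠ w') (hw₁ : b.coord w (γ s₁) = 0) (hw₂ : b.coord w (γ s₂) = 0)
    (hw₁' : b.coord w' (γ s₁) = 0) (hw₂' : b.coord w' (γ s₂) = 0) : False := by
  set Z := {t | b.coord w (γ t) = 0} ∩ {t | b.coord w' (γ t) = 0} with hZ
  have hcl : IsClosed Z := (isClosed_eq (continuous_coord_comp h.cont w) continuous_const).inter
    (isClosed_eq (continuous_coord_comp h.cont w') continuous_const)
  have hfill : ∀ {u v}, IsShortOn b γ u v → ∀ {s₁ s₂}, u < s₁ → s₂ < v → s₁ ∈ Z → s₂ ∈ Z →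
      ∀ s ∈ Icc s₁ s₂, s ∈ Z := by
    intro u v H s₁ s₂ h1 h3 g1 g2 s hs
    exact ⟨coord_eq_zero_of_wbtw (H.wbtw h1 hs.1 hs.2 h3 g1.1 g2.1) g1.1 g2.1,
      coord_eq_zero_of_wbtw (H.wbtw h1 hs.1 hs.2 h3 g1.1 g2.1) g1.2 g2.2⟩
  have hne : (interior Z).Nonempty := by
    refine ⟨(s₁ + s₂) / 2, mem_interior.2 ⟨Ioo s₁ s₂, fun s hs' => ?_, isOpen_Ioo, by
      constructor <;> linarith⟩⟩
    exact hfill hs h1 h3 ⟨hw₁, hw₁'⟩ ⟨hw₂, hw₂'⟩ s (Ioo_subset_Icc_self hs')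
  have hclosed : closure (interior Z) ⊆ interior Z := by
    intro t ht
    have htZ : t ∈ Z := closure_minimal interior_subset hcl ht
    obtain ⟨ε, hε, H⟩ := h.exists_isShortOn t
    have hpos : ∀ᶠ s in 𝓝 t, ∀ k, k ≠ w → k ≠ w' → 0 < b.coord k (γ s) := by
      rw [eventually_all]
      intro k
      by_cases hk : k = w ∨ k = w'
      · exact Eventually.of_forall fun s a1 a2 => by tauto
      push Not at hk
      have : 0 < b.coord k (γ t) := by
        refine lt_of_le_of_ne (h.nonneg t k) fun h0 => ?_
        obtain ⟨f1, f2, f3⟩ := fourth_ne k w w' hk.1 hk.2 hww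
        set y := fourth k w w'
        have hsum := sum_coord_eq b hk.1 hk.2 f1.symm hww f2.symm f3.symm (γ t)
        rw [← h0, show b.coord w (γ t) = 0 from htZ.1,
          show b.coord w' (γ t) = 0 from htZ.2] at hsum
        exact H.ne_vertex hb (by linarith) (by linarith) y
          (eq_vertex_of_coord_eq_one b (h.nonneg t) (by linarith))
      filter_upwards [(continuous_coord_comp h.cont k).continuousAt.eventually_const_lt this] with s hs _ _ using hs
    obtain ⟨δ, hδ, hδ'⟩ := Metric.eventually_nhds_iff.1 hpos
    obtain ⟨η, hη, e1, e2⟩ : ∃ η > 0, η ≤ ε ∧ η ≤ δ :=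
      ⟨min ε δ, by positivity, min_le_left _ _, min_le_right _ _⟩
    have hside : ∀ r s, |r - t| < η → |s - t| < η → r ∈ Z → (r < t ∧ t < s ∨ s < t ∧ t < r) →
        s ∈ Z := by
      intro r s hr hs hrZ hrs
      rw [abs_lt] at hr
      have hs' := hs
      rw [abs_lt] at hs'
      obtain ⟨k, hk⟩ := h.exists_zero s
      have hkk : k = w ∨ k = w' := by
        by_contra! hcon
        have := hδ' (y := s) (by rw [Real.dist_eq]; linarith) k hcon.1 hcon.2
        linarith
      have hkr : b.coord k (γ r) = 0 := by
        rcases hkk with rfl | rfl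
        · exact hrZ.1
        · exact hrZ.2
      have hsb : Sbtw ℝ (γ r) (γ t) (γ s) := by
        rcases hrs with ⟨a1, a2⟩ | ⟨a1, a2⟩
        · exact H.sbtw (by linarith) a1 a2 (by linarith) hkr hk
        · exact (H.sbtw (by linarith) a1 a2 (by linarith) hk hkr).symm
      obtain ⟨⟨m, ⟨hm0, hm1⟩, hm⟩, -⟩ := sbtw_iff_mem_image_Ioo_and_ne.1 hsb
      have hz : ∀ j, b.coord j (γ r) = 0 → b.coord j (γ t) = 0 → b.coord j (γ s) = 0 := by
        intro j j1 j2
        have := congrArg (b.coord j) hm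
        rw [AffineMap.apply_lineMap, AffineMap.lineMap_apply_ring, j1, j2] at this
        simpa [hm0.ne'] using this
      exact ⟨hz w hrZ.1 htZ.1, hz w' hrZ.2 htZ.2⟩
    obtain ⟨r, hr, hrZ⟩ : ∃ r, r ∈ Ioo (t - η) (t + η) ∧ r ∈ interior Z := by
      obtain ⟨r, hr1, hr2⟩ := mem_closure_iff.1 ht (Ioo (t - η) (t + η)) isOpen_Ioo
        ⟨by linarith, by linarith⟩
      exact ⟨r, hr1, hr2⟩
    have hrt : |r - t| < η := by rw [abs_lt]; constructor <;> linarith [hr.1, hr.2]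
    by_cases hrt' : r = t
    · rwa [← hrt']
    rw [mem_interior_iff_mem_nhds]
    refine Metric.eventually_nhds_iff.2 ⟨|r - t|, abs_pos.2 (sub_ne_zero.2 hrt'), fun s hs => ?_⟩
    rw [Real.dist_eq] at hs
    have hst := hs.trans hrt
    rcases lt_or_gt_of_ne hrt' with hlt | hgt
    · rw [abs_of_neg (by linarith : r - t < 0), abs_lt] at hs
      rcases le_or_gt s t with g | g
      · exact hfill H (by linarith [hr.1]) (by linarith) (interior_subset hrZ) htZ s
          ⟨by linarith, g⟩
      · exact hside r s hrt hst (interior_subset hrZ) (Or.inl ⟨hlt, g⟩)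
    · rw [abs_of_pos (by linarith : 0 < r - t), abs_lt] at hs
      rcases le_or_gt t s with g | g
      · exact hfill H (by linarith) (by linarith [hr.2]) htZ (interior_subset hrZ) s
          ⟨g, by linarith⟩
      · exact hside r s hrt hst (interior_subset hrZ) (Or.inr ⟨g, hgt⟩)
  have huniv : interior Z = univ :=
    IsClopen.eq_univ ⟨isClosed_of_closure_subset hclosed, isOpen_interior⟩ hne
  exact h.not_forall_coord_eq_zero w fun s =>
    (interior_subset (huniv ▸ mem_univ s : s ∈ interior Z)).1

/-- The times at which the curve meets an edge. -/
def edgeTimes (b : AffineBasis (Fin 4) ℝ (EuclideanSpace ℝ (Fin 3)))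
    (γ : ℝ → EuclideanSpace ℝ (Fin 3)) : Set ℝ :=
  {t | ∃ w w', w ≠ w' ∧ b.coord w (γ t) = 0 ∧ b.coord w' (γ t) = 0}

lemma LocallyShortest.exists_breaks (h : LocallyShortest b γ) (hb : PositiveCurvature b) :
    ∃ (n : ℕ) (t : ℕ → ℝ), n ≠ 0 ∧ StrictMono t ∧ (∀ k, t (k + n) = t k + 1) ∧
      (∀ k, t k ∈ edgeTimes b γ) ∧ ∀ k s, t k < s → s < t (k + 1) → s ∉ edgeTimes b γ := by
  have hcl : ∀ w w', IsClosed {t | b.coord w (γ t) = 0 ∧ b.coord w' (γ t) = 0} := fun w w' =>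
    (isClosed_eq (continuous_coord_comp h.cont w) continuous_const).inter
    (isClosed_eq (continuous_coord_comp h.cont w') continuous_const)
  have hTe : edgeTimes b γ = ⋃ p ∈ {p : Fin 4 × Fin 4 | p.1 ≠ p.2},
      {t | b.coord p.1 (γ t) = 0 ∧ b.coord p.2 (γ t) = 0} := by
    ext t
    simp only [edgeTimes, mem_ofPred_eq, mem_iUnion, exists_prop, Prod.exists]
  apply exists_enumeration
  · rw [hTe]
    exact (Set.toFinite _).isClosed_biUnion fun p _ => hcl p.1 p.2
  · intro t
    obtain ⟨ε, hε, H⟩ := h.exists_isShortOn t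
    have : ∀ w w', ∀ᶠ s in 𝓝[≠] t, ¬ (w ≠ w' ∧ b.coord w (γ s) = 0 ∧ b.coord w' (γ s) = 0) := by
      intro w w'
      by_cases ht : b.coord w (γ t) = 0 ∧ b.coord w' (γ t) = 0
      · rw [eventually_nhdsWithin_iff]
        refine Metric.eventually_nhds_iff.2 ⟨ε, hε, fun s hs hst hcon => ?_⟩
        rw [Real.dist_eq, abs_lt] at hs
        rcases lt_or_gt_of_ne hst with hlt | hgt
        · exact h.not_edge hb H (by linarith) hlt (by linarith) hcon.1 hcon.2.1 ht.1 hcon.2.2 ht.2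
        · exact h.not_edge hb H (by linarith) hgt (by linarith) hcon.1 ht.1 hcon.2.1 ht.2 hcon.2.2
      · refine nhdsWithin_le_nhds ?_
        filter_upwards [(hcl w w').isOpen_compl.mem_nhds ht] with s hs hcon using hs hcon.2
    simp only [← eventually_all] at this
    filter_upwards [this] with s hs hcon
    obtain ⟨w, w', hcon⟩ := hcon
    exact hs w w' hcon
  · intro t
    simp only [edgeTimes, mem_ofPred_eq, h.periodic t]
  · by_contra hne
    rw [not_nonempty_iff_eq_empty] at hne
    obtain ⟨w, hw⟩ := exists_face_of_isPreconnected h.cont h.exists_zero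
      (isPreconnected_univ (α := ℝ)) (fun s _ w w' h1 h2 => by
        by_contra hww
        have : s ∈ edgeTimes b γ := ⟨w, w', hww, h1, h2⟩
        rw [hne] at this
        exact this)
    exact h.not_forall_coord_eq_zero w fun s => hw s (mem_univ s)

end TetraGeodesic

namespace TetraGeodesic

open Set InnerProductGeometry Filter Topology

variable {b : AffineBasis (Fin 4) ℝ (EuclideanSpace ℝ (Fin 3))}
  {γ : ℝ → EuclideanSpace ℝ (Fin 3)} {u v : ℝ}

/-- `t k` are the successive times at which the curve `γ` meets edges, and `F k` is the face (given
by the opposite vertex) containing the curve between `t k` and `t (k + 1)`. -/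
structure Crossings (b : AffineBasis (Fin 4) ℝ (EuclideanSpace ℝ (Fin 3)))
    (γ : ℝ → EuclideanSpace ℝ (Fin 3)) (n : ℕ) (t : ℕ → ℝ) (F : ℕ → Fin 4) : Prop where
  strictMono : StrictMono t
  add_period : ∀ k, t (k + n) = t k + 1
  mem : ∀ k, t k ∈ edgeTimes b γ
  face : ∀ k, ∀ s ∈ Icc (t k) (t (k + 1)), b.coord (F k) (γ s) = 0
  unique : ∀ k s w, t k < s → s < t (k + 1) → b.coord w (γ s) = 0 → w = F k

lemma LocallyShortest.exists_crossings (h : LocallyShortest b γ) (hb : PositiveCurvature b) :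
    ∃ (n : ℕ) (t : ℕ → ℝ) (F : ℕ → Fin 4), n ≠ 0 ∧ Crossings b γ n t F := by
  obtain ⟨n, t, hn, hmono, hadd, hmem, hgap⟩ := h.exists_breaks hb
  have hu : ∀ k, ∀ s ∈ Ioo (t k) (t (k + 1)), ∀ w w', b.coord w (γ s) = 0 →
      b.coord w' (γ s) = 0 → w = w' := by
    intro k s hs w w' h1 h2
    by_contra hww
    exact hgap k s hs.1 hs.2 ⟨w, w', hww, h1, h2⟩
  have hF : ∀ k, ∃ w, ∀ s ∈ Ioo (t k) (t (k + 1)), b.coord w (γ s) = 0 := fun k =>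
    exists_face_of_isPreconnected h.cont h.exists_zero isPreconnected_Ioo (hu k)
  choose F hF using hF
  refine ⟨n, t, F, hn, hmono, hadd, hmem, fun k s hs => ?_, fun k s w h1 h2 hw =>
    hu k s ⟨h1, h2⟩ _ _ hw (hF k s ⟨h1, h2⟩)⟩
  have hcl : IsClosed {s | b.coord (F k) (γ s) = 0} :=
    isClosed_eq (continuous_coord_comp h.cont _) continuous_const
  rw [← closure_Ioo (hmono (Nat.lt_succ_self k)).ne] at hs
  exact closure_minimal (hF k) hcl hs

namespace Crossings

variable {n : ℕ} {t : ℕ → ℝ} {F : ℕ → Fin 4}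

lemma lt_succ (H : Crossings b γ n t F) (k : ℕ) : t k < t (k + 1) :=
  H.strictMono (Nat.lt_succ_self k)

lemma coord_pos (H : Crossings b γ n t F) (h : LocallyShortest b γ) {k : ℕ} {s : ℝ} {w : Fin 4}
    (h1 : t k < s) (h2 : s < t (k + 1)) (hw : w ≠ F k) : 0 < b.coord w (γ s) :=
  lt_of_le_of_ne (h.nonneg s w) fun h0 => hw (H.unique k s w h1 h2 h0.symm)

lemma face_add (H : Crossings b γ n t F) (h : LocallyShortest b γ) (k : ℕ) : F (k + n) = F k := by
  have h1 := H.lt_succ k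
  set m := (t k + t (k + 1)) / 2 with hm
  refine H.unique k m _ (by linarith) (by linarith) ?_
  have := H.face (k + n) (m + 1) (by
    rw [add_right_comm, H.add_period, H.add_period]
    constructor <;> linarith)
  rwa [h.periodic m] at this

lemma face_ne (H : Crossings b γ n t F) (h : LocallyShortest b γ) (k : ℕ) : F k ≠ F (k + 1) := by
  intro he
  obtain ⟨ε, hε, N⟩ := h.exists_isShortOn (t (k + 1))
  have h1 := H.lt_succ k
  have h2 := H.lt_succ (k + 1)
  obtain ⟨δ, hδ, d1, d2, d3⟩ : ∃ δ > 0, δ < ε ∧ t k < t (k + 1) - δ ∧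
      t (k + 1) + δ < t (k + 1 + 1) := by
    have := sub_pos.2 h1
    have := sub_pos.2 h2
    refine ⟨min (ε / 2) (min ((t (k + 1) - t k) / 2) ((t (k + 1 + 1) - t (k + 1)) / 2)),
      by positivity, ?_, ?_, ?_⟩
    · linarith [min_le_left (ε / 2) (min ((t (k + 1) - t k) / 2) ((t (k + 1 + 1) - t (k + 1)) / 2))]
    · linarith [(min_le_right (ε / 2) _).trans
        (min_le_left ((t (k + 1) - t k) / 2) ((t (k + 1 + 1) - t (k + 1)) / 2))]
    · linarith [(min_le_right (ε / 2) _).trans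
        (min_le_right ((t (k + 1) - t k) / 2) ((t (k + 1 + 1) - t (k + 1)) / 2))]
  have e1 := H.face k (t (k + 1) - δ) ⟨by linarith, by linarith⟩
  have e2 := H.face (k + 1) (t (k + 1) + δ) ⟨by linarith, by linarith⟩
  rw [← he] at e2
  have hs := N.sbtw (by linarith) (by linarith : t (k + 1) - δ < t (k + 1)) (by linarith)
    (by linarith) e1 e2
  obtain ⟨⟨m, ⟨hm0, hm1⟩, hm⟩, -⟩ := sbtw_iff_mem_image_Ioo_and_ne.1 hs
  obtain ⟨w, w', hww, hw, hw'⟩ := H.mem (k + 1)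
  have key : ∀ j, j ≠ F k → b.coord j (γ (t (k + 1))) ≠ 0 := by
    intro j hj
    rw [← hm, AffineMap.apply_lineMap, AffineMap.lineMap_apply_ring]
    have p1 := H.coord_pos h d2 (by linarith) hj
    have p2 := h.nonneg (t (k + 1) + δ) j
    have := mul_pos (sub_pos.2 hm1) p1
    have := mul_nonneg hm0.le p2
    linarith
  have a1 : w = F k := by by_contra hc; exact key w hc hw
  have a2 : w' = F k := by by_contra hc; exact key w' hc hw'
  exact hww (a1.trans a2.symm)

lemma ne_vertex (h : LocallyShortest b γ) (hb : PositiveCurvature b) (s : ℝ) (x : Fin 4) :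
    γ s ≠ b x := by
  obtain ⟨ε, hε, N⟩ := h.exists_isShortOn s
  exact N.ne_vertex hb (by linarith) (by linarith) x

lemma coord_eq_zero_iff (H : Crossings b γ n t F) (h : LocallyShortest b γ)
    (hb : PositiveCurvature b) (k : ℕ) (w : Fin 4) :
    b.coord w (γ (t (k + 1))) = 0 ↔ w = F k ∨ w = F (k + 1) := by
  have e1 := H.face k (t (k + 1)) ⟨(H.lt_succ k).le, le_rfl⟩
  have e2 := H.face (k + 1) (t (k + 1)) ⟨le_rfl, (H.lt_succ _).le⟩
  refine ⟨fun hw => ?_, ?_⟩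
  · by_contra! hcon
    obtain ⟨f1, f2, f3⟩ := fourth_ne w (F k) (F (k + 1)) hcon.1 hcon.2 (H.face_ne h k)
    have hsum := sum_coord_eq b hcon.1 hcon.2 f1.symm (H.face_ne h k) f2.symm f3.symm
      (γ (t (k + 1)))
    rw [e1, e2, hw] at hsum
    exact ne_vertex h hb _ _ (eq_vertex_of_coord_eq_one b (h.nonneg _) (by linarith))
  · rintro (rfl | rfl)
    · exact e1
    · exact e2

lemma face_ne_two (H : Crossings b γ n t F) (h : LocallyShortest b γ) (k : ℕ) :
    F k ≠ F (k + 1 + 1) := by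
  intro he
  have e1 := H.face k (t (k + 1)) ⟨(H.lt_succ k).le, le_rfl⟩
  have e2 := H.face (k + 1 + 1) (t (k + 1 + 1)) ⟨le_rfl, (H.lt_succ _).le⟩
  rw [← he] at e2
  have hl := H.lt_succ (k + 1)
  set m := (t (k + 1) + t (k + 1 + 1)) / 2 with hm
  have hw := h.wbtw_of_face (H.face (k + 1)) (s := m) ⟨by linarith, by linarith⟩
  exact H.face_ne h k (H.unique (k + 1) m _ (by linarith) (by linarith)
    (coord_eq_zero_of_wbtw hw e1 e2))

lemma snell (H : Crossings b γ n t F) (h : LocallyShortest b γ) (hb : PositiveCurvature b) (k : ℕ)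
    {y : Fin 4} (hy : y ≠ F k) (hy' : y ≠ F (k + 1)) :
    angle (γ (t k) - γ (t (k + 1))) (b y - γ (t (k + 1))) +
      angle (γ (t (k + 1 + 1)) - γ (t (k + 1))) (b y - γ (t (k + 1))) = Real.pi := by
  obtain ⟨ε, hε, N⟩ := h.exists_isShortOn (t (k + 1))
  have h1 := H.lt_succ k
  have h2 := H.lt_succ (k + 1)
  set P := γ (t (k + 1)) with hP
  obtain ⟨δ, hδ, d1, d2, d3⟩ : ∃ δ > 0, δ < ε ∧ t k < t (k + 1) - δ ∧
      t (k + 1) + δ < t (k + 1 + 1) := by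
    have := sub_pos.2 h1
    have := sub_pos.2 h2
    refine ⟨min (ε / 2) (min ((t (k + 1) - t k) / 2) ((t (k + 1 + 1) - t (k + 1)) / 2)),
      by positivity, ?_, ?_, ?_⟩
    · linarith [min_le_left (ε / 2) (min ((t (k + 1) - t k) / 2) ((t (k + 1 + 1) - t (k + 1)) / 2))]
    · linarith [(min_le_right (ε / 2) _).trans
        (min_le_left ((t (k + 1) - t k) / 2) ((t (k + 1 + 1) - t (k + 1)) / 2))]
    · linarith [(min_le_right (ε / 2) _).trans
        (min_le_right ((t (k + 1) - t k) / 2) ((t (k + 1 + 1) - t (k + 1)) / 2))]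
  have hne : ∀ s, t (k + 1) - ε < s → s < t (k + 1) + ε → s ≠ t (k + 1) → 0 < dist (γ s) P := by
    intro s hs hs' hst
    rw [dist_pos]
    exact fun he => hst (N.injOn ⟨hs, hs'⟩ ⟨by linarith, by linarith⟩ he)
  have hd1 := hne (t (k + 1) - δ) (by linarith) (by linarith) (by linarith)
  have hd2 := hne (t (k + 1) + δ) (by linarith) (by linarith) (by linarith)
  obtain ⟨r, hr, r1, r2⟩ : ∃ r > 0, r ≤ dist (γ (t (k + 1) - δ)) P ∧ r ≤ dist (γ (t (k + 1) + δ)) P :=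
    ⟨_, lt_min hd1 hd2, min_le_left _ _, min_le_right _ _⟩
  have hcont : Continuous fun s => dist (γ s) P := h.cont.dist continuous_const
  obtain ⟨s₁, hs₁, hr₁⟩ := intermediate_value_Icc' (by linarith : t (k + 1) - δ ≤ t (k + 1))
    hcont.continuousOn (show r ∈ Icc (dist (γ (t (k + 1))) P) (dist (γ (t (k + 1) - δ)) P) from
      ⟨by rw [← hP, dist_self]; exact hr.le, r1⟩)
  obtain ⟨s₂, hs₂, hr₂⟩ := intermediate_value_Icc (by linarith : t (k + 1) ≤ t (k + 1) + δ)
    hcont.continuousOn (show r ∈ Icc (dist (γ (t (k + 1))) P) (dist (γ (t (k + 1) + δ)) P) from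
      ⟨by rw [← hP, dist_self]; exact hr.le, r2⟩)
  simp only [dist_eq_norm] at hr₁ hr₂
  have z1 := H.face k s₁ ⟨by linarith [hs₁.1], hs₁.2⟩
  have z2 := H.face (k + 1) s₂ ⟨hs₂.1, by linarith [hs₂.2]⟩
  have hcy : 0 < b.coord y P := lt_of_le_of_ne (h.nonneg _ y) fun h0 => by
    rcases (H.coord_eq_zero_iff h hb k y).1 h0.symm with g | g
    exacts [hy g, hy' g]
  have hPz := (H.coord_eq_zero_iff h hb k (F k)).2 (Or.inl rfl)
  have hPz' := (H.coord_eq_zero_iff h hb k (F (k + 1))).2 (Or.inr rfl)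
  have hk : inner ℝ (γ s₁ - P) (b y - P) + inner ℝ (γ s₂ - P) (b y - P) = 0 := by
    by_contra hk
    obtain ⟨σ, hσ, hlt⟩ := exists_dist_add_dist_lt hr₁ hr₂ hr hk hcy
    rw [abs_lt] at hσ
    have hcoord : ∀ j, b.coord j (AffineMap.lineMap P (b y) σ) =
        (1 - σ) * b.coord j P + σ * b.coord j (b y) := fun j => by
      rw [AffineMap.apply_lineMap, AffineMap.lineMap_apply_ring]
    have c1 := coord_le_one b (h.nonneg (t (k + 1))) y
    rw [← hP] at c1
    have hnn : ∀ j, 0 ≤ b.coord j (AffineMap.lineMap P (b y) σ) := by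
      intro j
      rw [hcoord]
      by_cases hj : j = y
      · subst hj
        rw [b.coord_apply_eq]
        nlinarith
      · rw [b.coord_apply_ne hj]
        have := h.nonneg (t (k + 1)) j
        rw [← hP] at this
        have : 0 ≤ 1 - σ := by linarith
        simp only [mul_zero, add_zero]
        positivity
    have y1 : b.coord (F k) (AffineMap.lineMap P (b y) σ) = 0 := by
      rw [hcoord, hPz, b.coord_apply_ne hy.symm]; ring
    have y2 : b.coord (F (k + 1)) (AffineMap.lineMap P (b y) σ) = 0 := by
      rw [hcoord, hPz', b.coord_apply_ne hy'.symm]; ring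
    have := N.short s₁ (t (k + 1)) s₂ (by linarith [hs₁.1]) hs₁.2 hs₂.1 (by linarith [hs₂.2])
      (AffineMap.lineMap P (b y) σ) (AffineMap.lineMap P (b y) σ)
      ⟨h.nonneg _, hnn, _, z1, y1⟩ ⟨hnn, hnn, _, y1, y1⟩ ⟨hnn, h.nonneg _, _, y2, z2⟩
    rw [← hP, dist_comm P, dist_self, add_zero, dist_eq_norm, dist_eq_norm, dist_eq_norm,
      dist_eq_norm, hr₁, hr₂] at this
    simp only [AffineMap.lineMap_apply, vsub_eq_sub, vadd_eq_add] at this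
    rw [sub_add_eq_sub_sub_swap, add_sub_assoc _ P, ← neg_sub (γ s₂) P, ← sub_eq_add_neg] at this
    linarith
  have hd0 : 0 < ‖b y - P‖ := norm_pos_iff.2 (sub_ne_zero.2 (ne_vertex h hb _ y).symm)
  rw [← cos_angle_mul_norm_mul_norm, ← cos_angle_mul_norm_mul_norm, hr₁, hr₂, ← add_mul] at hk
  have hcos : Real.cos (angle (γ s₁ - P) (b y - P)) =
      Real.cos (Real.pi - angle (γ s₂ - P) (b y - P)) := by
    rw [Real.cos_pi_sub]
    have := (mul_eq_zero.1 hk).resolve_right (by positivity)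
    linarith
  have hang := Real.injOn_cos ⟨angle_nonneg _ _, angle_le_pi _ _⟩
    ⟨by linarith [angle_le_pi (γ s₂ - P) (b y - P)], by linarith [angle_nonneg (γ s₂ - P) (b y - P)]⟩
    hcos
  obtain ⟨m₁, ⟨g1, g2⟩, hm₁⟩ := h.wbtw_of_face (H.face k) (s := s₁) ⟨by linarith [hs₁.1], hs₁.2⟩
  obtain ⟨m₂, ⟨g3, g4⟩, hm₂⟩ := h.wbtw_of_face (H.face (k + 1)) (s := s₂)
    ⟨hs₂.1, by linarith [hs₂.2]⟩
  rw [← hP] at hm₁ hm₂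
  have x1 : γ s₁ - P = (1 - m₁) • (γ (t k) - P) := by
    rw [← hm₁, AffineMap.lineMap_apply, vsub_eq_sub, vadd_eq_add]; module
  have x2 : γ s₂ - P = m₂ • (γ (t (k + 1 + 1)) - P) := by
    rw [← hm₂, AffineMap.lineMap_apply, vsub_eq_sub, vadd_eq_add]; module
  have k1 : 0 < 1 - m₁ := by
    refine lt_of_le_of_ne (by linarith) fun h0 => ?_
    rw [x1, ← h0, zero_smul, norm_zero] at hr₁
    linarith
  have k2 : 0 < m₂ := by
    refine lt_of_le_of_ne g3 fun h0 => ?_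
    rw [x2, ← h0, zero_smul, norm_zero] at hr₂
    linarith
  rw [x1, x2, angle_smul_left_of_pos _ _ k1, angle_smul_left_of_pos _ _ k2] at hang
  linarith

end Crossings

/-- A closed geodesic polygon on the surface of a tetrahedron. The vertex `P i` is on the edge shared
by the faces opposite the vertices `f (i - 1)` and `f i`, and the side from `P i` to `P (i + 1)` is
in the face opposite `f i`. -/
structure GeodesicPolygon (b : AffineBasis (Fin 4) ℝ (EuclideanSpace ℝ (Fin 3))) (n : ℕ)
    (P : ZMod n → EuclideanSpace ℝ (Fin 3)) (f : ZMod n → Fin 4) : Prop where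
  nonneg : ∀ i w, 0 ≤ b.coord w (P i)
  coord_eq_zero_iff : ∀ i w, b.coord w (P i) = 0 ↔ w = f (i - 1) ∨ w = f i
  ne_succ : ∀ i, f (i - 1) ≠ f i
  ne_two : ∀ i, f (i - 1) ≠ f (i + 1)
  inj : Function.Injective P
  disjoint : ∀ i j, i ≠ j → f i = f j → ∀ Q, Wbtw ℝ (P i) Q (P (i + 1)) →
    ¬ Wbtw ℝ (P j) Q (P (j + 1))
  snell : ∀ i y, y ≠ f (i - 1) → y ≠ f i →
    angle (P (i - 1) - P i) (b y - P i) + angle (P (i + 1) - P i) (b y - P i) = Real.pi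

lemma LocallyShortest.exists_geodesicPolygon (h : LocallyShortest b γ) (hb : PositiveCurvature b) :
    ∃ (n : ℕ) (_ : NeZero n) (P : ZMod n → EuclideanSpace ℝ (Fin 3)) (f : ZMod n → Fin 4),
      GeodesicPolygon b n P f := by
  obtain ⟨n, t, F, hn, H⟩ := h.exists_crossings hb
  have : NeZero n := ⟨hn⟩
  have hFp : Function.Periodic F n := H.face_add h
  have hPp : Function.Periodic (fun k => γ (t k)) n := fun k => by
    simp only [H.add_period]; exact h.periodic _
  let P : ZMod n → EuclideanSpace ℝ (Fin 3) := fun i => γ (t i.val)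
  let f : ZMod n → Fin 4 := fun i => F i.val
  have hP : ∀ k : ℕ, P k = γ (t k) := fun k => by
    simp only [P, ZMod.val_natCast]; exact hPp.map_mod_nat k
  have hf : ∀ k : ℕ, f k = F k := fun k => by
    simp only [f, ZMod.val_natCast]; exact hFp.map_mod_nat k
  have hex : ∀ i : ZMod n, ∃ k : ℕ, i - 1 = (k : ZMod n) ∧ i = ((k + 1 : ℕ) : ZMod n) ∧
      i + 1 = ((k + 1 + 1 : ℕ) : ZMod n) := by
    intro i
    have : i - 1 = ((i - 1).val : ZMod n) := by rw [ZMod.natCast_val, ZMod.cast_id]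
    refine ⟨(i - 1).val, this, ?_, ?_⟩
    · push_cast; rw [← this]; ring
    · push_cast; rw [← this]; ring
  refine ⟨n, inferInstance, P, f, fun i w => h.nonneg _ w, fun i w => ?_, fun i => ?_, fun i => ?_,
    fun i j hij => ?_, fun i j hij hfij Q hi hj => ?_, fun i y hy hy' => ?_⟩
  · obtain ⟨k, e1, e2, -⟩ := hex i
    rw [e1, e2, hP, hf, hf]
    exact H.coord_eq_zero_iff h hb k w
  · obtain ⟨k, e1, e2, -⟩ := hex i
    rw [e1, e2, hf, hf]
    exact H.face_ne h k
  · obtain ⟨k, e1, e2, e3⟩ := hex i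
    rw [e1, e3, hf, hf]
    exact H.face_ne_two h k
  · have hb1 : ∀ i : ZMod n, t 0 ≤ t i.val ∧ t i.val < t 0 + 1 := fun i =>
      ⟨H.strictMono.monotone (Nat.zero_le _), by
        rw [← H.add_period, zero_add]; exact H.strictMono (ZMod.val_lt i)⟩
    have := h.eq_of_eq (show γ (t i.val) = γ (t j.val) from hij) (by
      have := hb1 i
      have := hb1 j
      rw [abs_lt]; constructor <;> linarith)
    exact ZMod.val_injective n (H.strictMono.injective this)
  · have hs : ∀ i : ZMod n, i + 1 = ((i.val + 1 : ℕ) : ZMod n) := fun i => by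
      push_cast; rw [ZMod.natCast_val, ZMod.cast_id]
    have key : ∀ i : ZMod n, Wbtw ℝ (P i) Q (P (i + 1)) →
        ∃ s ∈ Icc (t i.val) (t (i.val + 1)), γ s = Q := by
      intro i hi
      rw [hs, hP] at hi
      exact h.exists_eq_of_wbtw (H.lt_succ _).le (H.face i.val) hi
    obtain ⟨s, hs1, hsQ⟩ := key i hi
    obtain ⟨s', hs1', hsQ'⟩ := key j hj
    obtain ⟨z, hz⟩ := Int.fract_eq_fract.1 ((h.eq_iff s s').1 (hsQ.trans hsQ'.symm))
    have tshift : ∀ (m k : ℕ), t (k + m * n) = t k + m := by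
      intro m k
      induction m with
      | zero => simp
      | succ m ih =>
        rw [show k + (m + 1) * n = k + m * n + n by ring, H.add_period, ih]; push_cast; ring
    have fin : ∀ (k l : ℕ) (s : ℝ), (k : ZMod n) ≠ (l : ZMod n) → F k = F l →
        s ∈ Icc (t k) (t (k + 1)) → s ∈ Icc (t l) (t (l + 1)) → False := by
      have aux : ∀ (k l : ℕ) (s : ℝ), k < l → F k = F l →
          s ∈ Icc (t k) (t (k + 1)) → s ∈ Icc (t l) (t (l + 1)) → False := by
        intro k l s hkl hF g1 g2
        have : l ≤ k + 1 := H.strictMono.le_iff_le.1 (g2.1.trans g1.2)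
        obtain rfl : l = k + 1 := by omega
        exact H.face_ne h k hF
      intro k l s hkl hF g1 g2
      rcases lt_trichotomy k l with g | rfl | g
      · exact aux k l s g hF g1 g2
      · exact hkl rfl
      · exact aux l k s g hF.symm g2 g1
    have hcast : ∀ (i : ZMod n) (m : ℕ), ((i.val + m * n : ℕ) : ZMod n) = i := fun i m => by
      push_cast; rw [ZMod.natCast_val, ZMod.cast_id]; simp
    have hFc : ∀ (i : ZMod n) (m : ℕ), F (i.val + m * n) = f i := fun i m => by
      rw [← hf, hcast]
    rcases le_total 0 z with hz0 | hz0
    · obtain ⟨m, rfl⟩ := Int.eq_ofNat_of_zero_le hz0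
      refine fin (i.val + 0 * n) (j.val + m * n) s (by rw [hcast, hcast]; exact hij)
        (by rw [hFc, hFc]; exact hfij) (by simpa using hs1) ?_
      rw [add_right_comm, tshift, tshift]
      simp only [Int.cast_natCast] at hz
      constructor <;> linarith [hs1'.1, hs1'.2]
    · obtain ⟨m, hm⟩ := Int.eq_ofNat_of_zero_le (neg_nonneg.2 hz0)
      refine fin (j.val + 0 * n) (i.val + m * n) s' (by rw [hcast, hcast]; exact hij.symm)
        (by rw [hFc, hFc]; exact hfij.symm) (by simpa using hs1') ?_
      rw [add_right_comm, tshift, tshift]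
      have : (m : ℝ) = -z := by exact_mod_cast hm.symm
      constructor <;> linarith [hs1.1, hs1.2]
  · obtain ⟨k, e1, e2, e3⟩ := hex i
    rw [e1, hf] at hy
    rw [e2, hf] at hy'
    have := H.snell h hb k hy hy'
    rw [e3, e1, e2, hP, hP, hP]
    exact this

end TetraGeodesic

namespace TetraGeodesic

open Set InnerProductGeometry

variable {b : AffineBasis (Fin 4) ℝ (EuclideanSpace ℝ (Fin 3))}

lemma mem_of_distinct : ∀ x w p q i : Fin 4, x ≠ w → x ≠ p → x ≠ q → w ≠ p → w ≠ q → p ≠ q →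
    i = x ∨ i = w ∨ i = p ∨ i = q := by decide

/-- Two segments in a face meet if the first cuts off the corner `x` and the second has its end
points on different sides of the first. -/
lemma exists_wbtw_of_separated {x w p q : Fin 4} (hxw : x ≠ w) (hxp : x ≠ p) (hxq : x ≠ q)
    (hwp : w ≠ p) (hwq : w ≠ q) (hpq : p ≠ q) {A₁ A₂ B₁ B₂ : EuclideanSpace ℝ (Fin 3)}
    (hA₁w : b.coord w A₁ = 0) (hA₁q : b.coord q A₁ = 0) (hA₁ : 0 < b.coord p A₁)
    (hA₂w : b.coord w A₂ = 0) (hA₂p : b.coord p A₂ = 0) (hA₂ : 0 < b.coord q A₂)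
    (hB₁w : b.coord w B₁ = 0) (hB₁q : b.coord q B₁ = 0) (hB₁ : 0 ≤ b.coord p B₁)
    (hB₂w : b.coord w B₂ = 0) (hB₂p : 0 ≤ b.coord p B₂) (hB₂q : 0 ≤ b.coord q B₂)
    (h₁ : b.coord p B₁ < b.coord p A₁)
    (h₂ : 1 ≤ b.coord p B₂ / b.coord p A₁ + b.coord q B₂ / b.coord q A₂) :
    ∃ Q, Wbtw ℝ A₁ Q A₂ ∧ Wbtw ℝ B₁ Q B₂ := by
  obtain ⟨u, hu⟩ : ∃ u, u = b.coord p A₁ := ⟨_, rfl⟩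
  obtain ⟨v, hv⟩ : ∃ v, v = b.coord q A₂ := ⟨_, rfl⟩
  obtain ⟨α, hα⟩ : ∃ α, α = b.coord p B₁ / u := ⟨_, rfl⟩
  obtain ⟨β, hβ⟩ : ∃ β, β = b.coord p B₂ / u := ⟨_, rfl⟩
  obtain ⟨μ, hμ⟩ : ∃ μ, μ = b.coord q B₂ / v := ⟨_, rfl⟩
  rw [← hu, ← hv, ← hβ, ← hμ] at h₂
  rw [← hu] at hA₁ h₁
  rw [← hv] at hA₂
  have hα1 : α < 1 := by rw [hα, div_lt_one hA₁]; exact h₁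
  have hα0 : 0 ≤ α := by rw [hα]; positivity
  have hβ0 : 0 ≤ β := by rw [hβ]; positivity
  have hμ0 : 0 ≤ μ := by rw [hμ]; positivity
  have eα : b.coord p B₁ = α * u := by rw [hα]; field_simp
  have eβ : b.coord p B₂ = β * u := by rw [hβ]; field_simp
  have eμ : b.coord q B₂ = μ * v := by rw [hμ]; field_simp
  have hD : 0 < β + μ - α := by linarith
  obtain ⟨t, ht⟩ : ∃ t, t = (1 - α) / (β + μ - α) := ⟨_, rfl⟩
  have ht0 : 0 ≤ t := by rw [ht]; exact div_nonneg (by linarith) hD.le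
  have ht1 : t ≤ 1 := by rw [ht, div_le_one hD]; linarith
  have hte : t * (β + μ - α) = 1 - α := by rw [ht]; field_simp
  have hs0 : 0 ≤ t * μ := mul_nonneg ht0 hμ0
  have hs1 : t * μ ≤ 1 := by
    have := mul_nonneg (sub_nonneg.2 ht1) hα0
    have := mul_nonneg ht0 hβ0
    nlinarith
  refine ⟨AffineMap.lineMap B₁ B₂ t, ⟨t * μ, ⟨hs0, hs1⟩, ?_⟩, ⟨t, ⟨ht0, ht1⟩, rfl⟩⟩
  have cw : b.coord w (AffineMap.lineMap A₁ A₂ (t * μ)) =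
      b.coord w (AffineMap.lineMap B₁ B₂ t) := by
    simp only [AffineMap.apply_lineMap, AffineMap.lineMap_apply_ring, hA₁w, hA₂w, hB₁w, hB₂w]
    ring
  have cp : b.coord p (AffineMap.lineMap A₁ A₂ (t * μ)) =
      b.coord p (AffineMap.lineMap B₁ B₂ t) := by
    simp only [AffineMap.apply_lineMap, AffineMap.lineMap_apply_ring, hA₂p, eα, eβ, ← hu]
    linear_combination -u * hte
  have cq : b.coord q (AffineMap.lineMap A₁ A₂ (t * μ)) =
      b.coord q (AffineMap.lineMap B₁ B₂ t) := by
    simp only [AffineMap.apply_lineMap, AffineMap.lineMap_apply_ring, hA₁q, hB₁q, eμ, ← hv]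
    ring
  have s1 := sum_coord_eq b hxw hxp hxq hwp hwq hpq (AffineMap.lineMap A₁ A₂ (t * μ))
  have s2 := sum_coord_eq b hxw hxp hxq hwp hwq hpq (AffineMap.lineMap B₁ B₂ t)
  refine eq_of_coord_eq b fun i => ?_
  rcases mem_of_distinct x w p q i hxw hxp hxq hwp hwq hpq with rfl | rfl | rfl | rfl
  · linarith
  · exact cw
  · exact cp
  · exact cq

namespace GeodesicPolygon

variable {n : ℕ} {P : ZMod n → EuclideanSpace ℝ (Fin 3)} {f : ZMod n → Fin 4}

lemma ne_succ' (h : GeodesicPolygon b n P f) (i : ZMod n) : f i ≠ f (i + 1) := by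
  have := h.ne_succ (i + 1)
  rwa [add_sub_cancel_right] at this

lemma coord_pos (h : GeodesicPolygon b n P f) {i : ZMod n} {w : Fin 4} (h1 : w ≠ f (i - 1))
    (h2 : w ≠ f i) : 0 < b.coord w (P i) :=
  lt_of_le_of_ne (h.nonneg i w) fun h0 => by
    rcases (h.coord_eq_zero_iff i w).1 h0.symm with k | k
    exacts [h1 k, h2 k]

lemma coord_eq_zero_left (h : GeodesicPolygon b n P f) (i : ZMod n) :
    b.coord (f (i - 1)) (P i) = 0 := (h.coord_eq_zero_iff i _).2 (Or.inl rfl)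

lemma coord_eq_zero_right (h : GeodesicPolygon b n P f) (i : ZMod n) :
    b.coord (f i) (P i) = 0 := (h.coord_eq_zero_iff i _).2 (Or.inr rfl)

lemma coord_succ_eq_zero (h : GeodesicPolygon b n P f) (i : ZMod n) :
    b.coord (f i) (P (i + 1)) = 0 := by
  have := h.coord_eq_zero_left (i + 1)
  rwa [add_sub_cancel_right] at this

lemma coord_succ_pos (h : GeodesicPolygon b n P f) {i : ZMod n} {w : Fin 4} (h1 : w ≠ f i)
    (h2 : w ≠ f (i + 1)) : 0 < b.coord w (P (i + 1)) :=
  h.coord_pos (by rwa [add_sub_cancel_right]) h2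

/-- The position of an arc in its face, traversed in one of the two directions. -/
lemma arc (h : GeodesicPolygon b n P f) (a : ZMod n) (s : Bool) :
    cond s (f (a + 1)) (f (a - 1)) ≠ cond s (f (a - 1)) (f (a + 1)) ∧
    f a ≠ cond s (f (a + 1)) (f (a - 1)) ∧ f a ≠ cond s (f (a - 1)) (f (a + 1)) ∧
    b.coord (f a) (P (cond s (a + 1) a)) = 0 ∧ b.coord (f a) (P (cond s a (a + 1))) = 0 ∧
    b.coord (cond s (f (a + 1)) (f (a - 1))) (P (cond s (a + 1) a)) = 0 ∧
    b.coord (cond s (f (a - 1)) (f (a + 1))) (P (cond s a (a + 1))) = 0 ∧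
    (∀ v, v ≠ f a → v ≠ cond s (f (a + 1)) (f (a - 1)) → 0 < b.coord v (P (cond s (a + 1) a))) ∧
    (∀ v, v ≠ f a → v ≠ cond s (f (a - 1)) (f (a + 1)) → 0 < b.coord v (P (cond s a (a + 1)))) ∧
    ∀ Q, Wbtw ℝ (P (cond s (a + 1) a)) Q (P (cond s a (a + 1))) → Wbtw ℝ (P a) Q (P (a + 1)) := by
  cases s
  · exact ⟨h.ne_two a, (h.ne_succ a).symm, h.ne_succ' a, h.coord_eq_zero_right a,
      h.coord_succ_eq_zero a, h.coord_eq_zero_left a, h.coord_eq_zero_right _,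
      fun v h1 h2 => h.coord_pos h2 h1, fun v h1 h2 => h.coord_succ_pos h1 h2, fun Q hQ => hQ⟩
  · exact ⟨(h.ne_two a).symm, h.ne_succ' a, (h.ne_succ a).symm, h.coord_succ_eq_zero a,
      h.coord_eq_zero_right a, h.coord_eq_zero_right _, h.coord_eq_zero_left a,
      fun v h1 h2 => h.coord_succ_pos h1 h2, fun v h1 h2 => h.coord_pos h2 h1,
      fun Q hQ => hQ.symm⟩

lemma noncross (h : GeodesicPolygon b n P f) (a d : ZMod n) (x : Fin 4) (had : a ≠ d)
    (hf : f a = f d) (hx : x = fourth (f (a - 1)) (f a) (f (a + 1))) (s t : Bool)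
    (hst : cond s (f (a + 1)) (f (a - 1)) = cond t (f (d + 1)) (f (d - 1)))
    (hlt : b.coord x (P (cond s (a + 1) a)) < b.coord x (P (cond t (d + 1) d))) :
    cond s (f (a - 1)) (f (a + 1)) = cond t (f (d - 1)) (f (d + 1)) ∧
      b.coord x (P (cond s a (a + 1))) < b.coord x (P (cond t d (d + 1))) := by
  obtain ⟨hx1, hx2, hx3⟩ := fourth_ne _ _ _ (h.ne_succ a) (h.ne_two a) (h.ne_succ' a)
  rw [← hx] at hx1 hx2 hx3
  obtain ⟨hpq, hwq, hwp, A₁w, A₂w, A₁q, A₂p, A₁0, A₂0, hA⟩ := h.arc a s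
  obtain ⟨hpq', hwq', hwp', B₁w, B₂w, B₁q, B₂p, B₁0, B₂0, hB⟩ := h.arc d t
  have hxq : x ≠ cond s (f (a + 1)) (f (a - 1)) := by cases s <;> assumption
  have hxp : x ≠ cond s (f (a - 1)) (f (a + 1)) := by cases s <;> assumption
  rw [← hf] at hwq' hwp' B₁w B₂w B₁0 B₂0
  rw [← hst] at hpq' hwq' B₁q B₁0
  generalize cond s (f (a + 1)) (f (a - 1)) = q at *
  generalize cond s (f (a - 1)) (f (a + 1)) = p at *
  generalize cond t (f (d - 1)) (f (d + 1)) = p' at *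
  generalize P (cond s (a + 1) a) = A₁ at *
  generalize P (cond s a (a + 1)) = A₂ at *
  have nB₁ : ∀ w, 0 ≤ b.coord w (P (cond t (d + 1) d)) := h.nonneg _
  have nB₂ : ∀ w, 0 ≤ b.coord w (P (cond t d (d + 1))) := h.nonneg _
  generalize P (cond t (d + 1) d) = B₁ at *
  generalize P (cond t d (d + 1)) = B₂ at *
  have sA₁ := sum_coord_eq b hx2 hxp hxq hwp hwq hpq.symm A₁
  have sA₂ := sum_coord_eq b hx2 hxp hxq hwp hwq hpq.symm A₂
  have sB₁ := sum_coord_eq b hx2 hxp hxq hwp hwq hpq.symm B₁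
  have sB₂ := sum_coord_eq b hx2 hxp hxq hwp hwq hpq.symm B₂
  have pA₁ := A₁0 p hwp.symm hpq.symm
  have pA₂ := A₂0 q hwq.symm hpq
  have xA₁ := A₁0 x hx2 hxq
  have xA₂ := A₂0 x hx2 hxp
  have hp' : p' = p ∨ p' = x := by
    rcases mem_of_distinct x _ p q p' hx2 hxp hxq hwp hwq hpq.symm with k | k | k | k
    exacts [Or.inr k, absurd k.symm hwp', Or.inl k, absurd k.symm hpq']
  by_contra hcon
  have key : 1 ≤ b.coord p B₂ / b.coord p A₁ + b.coord q B₂ / b.coord q A₂ := by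
    rcases hp' with rfl | rfl
    · rw [B₂p, zero_div, zero_add, one_le_div pA₂]
      have := not_and.1 hcon rfl
      linarith
    · have k1 : b.coord p B₂ ≤ b.coord p B₂ / b.coord p A₁ :=
        le_div_self (nB₂ p) pA₁ (by linarith)
      have k2 : b.coord q B₂ ≤ b.coord q B₂ / b.coord q A₂ :=
        le_div_self (nB₂ q) pA₂ (by linarith)
      linarith
  obtain ⟨Q, hQ1, hQ2⟩ := exists_wbtw_of_separated hx2 hxp hxq hwp hwq hpq.symm A₁w A₁q pA₁ A₂w
    A₂p pA₂ B₁w B₁q (nB₁ p) B₂w (nB₂ p) (nB₂ q) (by linarith) key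
  exact h.disjoint a d had hf Q (hA Q hQ1) (hB Q hQ2)

lemma arcSystem (h : GeodesicPolygon b n P f) : ArcSystem n f fun i u => b.coord u (P i) where
  ne_succ := h.ne_succ
  ne_succ' := h.ne_succ'
  ne_two := h.ne_two
  noncross := h.noncross
  inj := by
    intro i j y z hij hy hy' hz hz' hyz hor
    have hj : b.coord (f (i - 1)) (P j) = 0 ∧ b.coord (f i) (P j) = 0 := by
      have h1 := h.coord_eq_zero_left j
      have h2 := h.coord_eq_zero_right j
      rcases hor with ⟨e1, e2⟩ | ⟨e1, e2⟩ <;> rw [e1] at h1 <;> rw [e2] at h2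
      exacts [⟨h1, h2⟩, ⟨h2, h1⟩]
    have si := sum_coord_eq b hy hyz hy' hz.symm (h.ne_succ i) hz' (P i)
    have sj := sum_coord_eq b hy hyz hy' hz.symm (h.ne_succ i) hz' (P j)
    rw [h.coord_eq_zero_left, h.coord_eq_zero_right] at si
    rw [hj.1, hj.2] at sj
    refine ⟨fun he => hij (h.inj (eq_of_coord_eq b fun k => ?_)), ?_⟩
    · rcases mem_of_distinct y _ z _ k hy hyz hy' hz.symm (h.ne_succ i) hz' with
        rfl | rfl | rfl | rfl
      · exact he
      · rw [h.coord_eq_zero_left, hj.1]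
      · linarith
      · rw [h.coord_eq_zero_right, hj.2]
    · constructor <;> intro <;> linarith

end GeodesicPolygon
end TetraGeodesic

namespace TetraGeodesic

open Set InnerProductGeometry

variable {b : AffineBasis (Fin 4) ℝ (EuclideanSpace ℝ (Fin 3))}

/-- The angles at an edge point towards the two ends of the edge are supplementary. -/
lemma angle_add_angle_edge {x w p q : Fin 4} (hxw : x ≠ w) (hxp : x ≠ p) (hxq : x ≠ q)
    (hwp : w ≠ p) (hwq : w ≠ q) (hpq : p ≠ q) {P : EuclideanSpace ℝ (Fin 3)}
    (hw : b.coord w P = 0) (hq : b.coord q P = 0) (hx : 0 < b.coord x P) (hp : 0 < b.coord p P)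
    (v : EuclideanSpace ℝ (Fin 3)) : angle v (b x - P) + angle v (b p - P) = Real.pi := by
  have h1 := sub_vertex_eq b hxw hxp hxq hwp hwq hpq hw
  have h2 := sub_vertex_eq b hwp.symm hxp.symm hpq hxw.symm hwq hxq hw
  rw [hq, zero_smul, add_zero] at h1 h2
  have e1 : b x - P = b.coord p P • (b x - b p) := by
    rw [← neg_sub, h1, ← smul_neg, neg_sub]
  have e2 : b p - P = b.coord x P • -(b x - b p) := by
    rw [← neg_sub, h2, ← smul_neg]
  rw [e1, e2, angle_smul_right_of_pos _ _ hp, angle_smul_right_of_pos _ _ hx, angle_neg_right]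
  ring

namespace GeodesicPolygon

open ArcSystem

variable {n : ℕ} {P : ZMod n → EuclideanSpace ℝ (Fin 3)} {f : ZMod n → Fin 4}

/-- The signed deviation of the curve from the normal of the edge it crosses. -/
noncomputable def deviation (b : AffineBasis (Fin 4) ℝ (EuclideanSpace ℝ (Fin 3)))
    (P : ZMod n → EuclideanSpace ℝ (Fin 3)) (f : ZMod n → Fin 4) (i : ZMod n) : ℝ :=
  cornerSign (corner f i) (f (i - 1)) (f i) *
    (angle (P (i + 1) - P i) (b (corner f i) - P i) - Real.pi / 2)

lemma deviation_eq (h : GeodesicPolygon b n P f) (i : ZMod n) {y : Fin 4} (h1 : y ≠ f (i - 1))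
    (h2 : y ≠ f i) : deviation b P f i = cornerSign y (f (i - 1)) (f i) *
      (angle (P (i + 1) - P i) (b y - P i) - Real.pi / 2) := by
  obtain ⟨c1, c2, -⟩ := fourth_ne _ _ _ (h.ne_succ i) (h.ne_two i) (h.ne_succ' i)
  unfold deviation corner
  generalize fourth (f (i - 1)) (f i) (f (i + 1)) = x at *
  by_cases hxy : x = y
  · rw [hxy]
  · have := angle_add_angle_edge c1 hxy c2 h1.symm (h.ne_succ i) h2 (h.coord_eq_zero_left i)
      (h.coord_eq_zero_right i) (h.coord_pos c1 c2) (h.coord_pos h1 h2) (P (i + 1) - P i)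
    rw [cornerSign_other x y _ _ hxy c1 c2 h1 h2 (h.ne_succ i)]
    push_cast
    linear_combination (cornerSign x (f (i - 1)) (f i) : ℝ) * this

lemma deviation_succ (h : GeodesicPolygon b n P f) {θ : Fin 4 → Fin 4 → ℝ}
    (hθ : ∀ x w p q, x ≠ w → x ≠ p → x ≠ q → w ≠ p → w ≠ q → p ≠ q →
      θ x w = angle (b p - b x) (b q - b x)) (i : ZMod n) :
    deviation b P f (i + 1) = deviation b P f i +
      cornerSign (corner f i) (f (i - 1)) (f i) * θ (corner f i) (f i) := by
  obtain ⟨c1, c2, c3⟩ := fourth_ne _ _ _ (h.ne_succ i) (h.ne_two i) (h.ne_succ' i)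
  rw [h.deviation_eq (i + 1) (y := corner f i) (by rw [add_sub_cancel_right]; exact c2) c3,
    h.deviation_eq i c1 c2, add_sub_cancel_right]
  unfold corner
  generalize fourth (f (i - 1)) (f i) (f (i + 1)) = x at *
  have hs := h.snell (i + 1) x (by rw [add_sub_cancel_right]; exact c2) c3
  rw [add_sub_cancel_right] at hs
  have e1 := sub_vertex_eq b c1 c3 c2 (h.ne_two i) (h.ne_succ i) (h.ne_succ' i).symm
    (h.coord_eq_zero_left i)
  rw [h.coord_eq_zero_right, zero_smul, add_zero] at e1
  have e2 := sub_vertex_eq b c2 c1 c3 (h.ne_succ i).symm (h.ne_succ' i) (h.ne_two i)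
    (h.coord_succ_eq_zero i)
  rw [h.coord_eq_zero_right, zero_smul, add_zero] at e2
  have p1 := h.coord_pos (h.ne_two i).symm (h.ne_succ' i).symm
  have p2 := h.coord_succ_pos (h.ne_succ i) (h.ne_two i)
  have hang : angle (P i - b x) (P (i + 1) - b x) = θ x (f i) := by
    rw [e1, e2, angle_smul_left_of_pos _ _ p1, angle_smul_right_of_pos _ _ p2,
      hθ x (f i) (f (i + 1)) (f (i - 1)) c2 c3 c1 (h.ne_succ' i) (h.ne_succ i).symm
        (h.ne_two i).symm]
  have hne : P i ≠ b x := fun he => by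
    rw [he, b.coord_apply_ne c3.symm] at p1
    exact p1.false
  have htri := EuclideanGeometry.angle_add_angle_add_angle_eq_pi (P := EuclideanSpace ℝ (Fin 3))
    (p₁ := b x) (p₂ := P i) (P (i + 1)) hne
  simp only [EuclideanGeometry.angle, vsub_eq_sub] at htri
  rw [angle_comm (P (i + 1) - b x), hang, angle_comm (b x - P i)] at htri
  rw [cornerSign_rotate x _ _ _ c1 c2 c3 (h.ne_succ i) (h.ne_two i) (h.ne_succ' i)]
  linear_combination (cornerSign x (f (i - 1)) (f i) : ℝ) * (hs - htri)

lemma sum_eq_zero [NeZero n] (h : GeodesicPolygon b n P f) {θ : Fin 4 → Fin 4 → ℝ}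
    (hθ : ∀ x w p q, x ≠ w → x ≠ p → x ≠ q → w ≠ p → w ≠ q → p ≠ q →
      θ x w = angle (b p - b x) (b q - b x)) :
    ∑ i, (cornerSign (corner f i) (f (i - 1)) (f i) : ℝ) * θ (corner f i) (f i) = 0 := by
  have h1 : ∑ i, deviation b P f (i + 1) = ∑ i, deviation b P f i :=
    Equiv.sum_comp (Equiv.addRight (1 : ZMod n)) (deviation b P f)
  simp only [h.deviation_succ hθ, Finset.sum_add_distrib] at h1
  linarith

end GeodesicPolygon
end TetraGeodesic

namespace TetraGeodesic

open Set InnerProductGeometry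

lemma angle_eq_arccos_of_dist (X Y Z : EuclideanSpace ℝ (Fin 3)) :
    angle (Y - X) (Z - X) =
      Real.arccos ((dist X Y ^ 2 + dist X Z ^ 2 - dist Y Z ^ 2) / 2 / (dist X Y * dist X Z)) := by
  have h : inner ℝ (Y - X) (Z - X) = (dist X Y ^ 2 + dist X Z ^ 2 - dist Y Z ^ 2) / 2 := by
    have := norm_sub_sq_real (Y - X) (Z - X)
    rw [sub_sub_sub_cancel_right] at this
    rw [dist_comm X Y, dist_comm X Z, dist_eq_norm, dist_eq_norm, dist_eq_norm]
    linarith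
  rw [angle, h, ← dist_eq_norm, ← dist_eq_norm, dist_comm Y X, dist_comm Z X]

/-- The vertices of `b` form a right triangular pyramid with base edge `a`, lateral edge `l` and
apex `b 3`. -/
structure IsRightPyramid (b : AffineBasis (Fin 4) ℝ (EuclideanSpace ℝ (Fin 3))) (a l : ℝ) :
    Prop where
  base : ∀ x y, x ≠ 3 → y ≠ 3 → x ≠ y → dist (b x) (b y) = a
  lateral : ∀ x, x ≠ 3 → dist (b 3) (b x) = l

namespace IsRightPyramid

variable {b : AffineBasis (Fin 4) ℝ (EuclideanSpace ℝ (Fin 3))} {a l : ℝ}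

/-- The angle of the face opposite to `w` at the vertex `x`, where `β` is the lateral base angle. -/
noncomputable def faceAngle (β : ℝ) (x w : Fin 4) : ℝ :=
  if x = 3 then Real.pi - 2 * β else if w = 3 then Real.pi / 3 else β

lemma base_pos (h : IsRightPyramid b a l) : 0 < a := by
  rw [← h.base 0 1 (by decide) (by decide) (by decide), dist_pos]
  exact b.ind.injective.ne (by decide)

lemma lateral_pos (h : IsRightPyramid b a l) : 0 < l := by
  rw [← h.lateral 0 (by decide), dist_pos]
  exact b.ind.injective.ne (by decide)

lemma angle_base (h : IsRightPyramid b a l) {x p q : Fin 4} (hx : x ≠ 3) (hp : p ≠ 3)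
    (hq : q ≠ 3) (hxp : x ≠ p) (hxq : x ≠ q) (hpq : p ≠ q) :
    angle (b p - b x) (b q - b x) = Real.pi / 3 := by
  have ha := h.base_pos
  rw [angle_eq_arccos_of_dist, h.base x p hx hp hxp, h.base x q hx hq hxq, h.base p q hp hq hpq]
  have : (a ^ 2 + a ^ 2 - a ^ 2) / 2 / (a * a) = Real.cos (Real.pi / 3) := by
    rw [Real.cos_pi_div_three]; field_simp; ring
  rw [this, Real.arccos_cos (by positivity) (by linarith [Real.pi_pos])]

lemma angle_lateral (h : IsRightPyramid b a l) {x p : Fin 4} (hx : x ≠ 3) (hp : p ≠ 3)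
    (hxp : x ≠ p) : angle (b p - b x) (b 3 - b x) = Real.arccos (a / (2 * l)) := by
  have ha := h.base_pos
  have hl := h.lateral_pos
  rw [angle_eq_arccos_of_dist, h.base x p hx hp hxp, dist_comm (b x) (b 3), dist_comm (b p) (b 3),
    h.lateral x hx, h.lateral p hp]
  congr 1
  field_simp
  ring

lemma angle_apex (h : IsRightPyramid b a l) {p q : Fin 4} (hp : p ≠ 3) (hq : q ≠ 3)
    (hpq : p ≠ q) :
    angle (b p - b 3) (b q - b 3) = Real.pi - 2 * Real.arccos (a / (2 * l)) := by
  have h1 := h.angle_lateral hp hq hpq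
  have h2 := h.angle_lateral hq hp hpq.symm
  have h3 := EuclideanGeometry.angle_add_angle_add_angle_eq_pi (P := EuclideanSpace ℝ (Fin 3))
    (p₁ := b 3) (p₂ := b p) (b q) (b.ind.injective.ne hp)
  simp only [EuclideanGeometry.angle, vsub_eq_sub] at h3
  rw [angle_comm (b 3 - b p), h1, h2, angle_comm (b q - b 3)] at h3
  linarith

lemma angle_eq_faceAngle (h : IsRightPyramid b a l) (x w p q : Fin 4) (hxw : x ≠ w)
    (hxp : x ≠ p) (hxq : x ≠ q) (hwp : w ≠ p) (hwq : w ≠ q) (hpq : p ≠ q) :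
    faceAngle (Real.arccos (a / (2 * l))) x w = angle (b p - b x) (b q - b x) := by
  rcases mem_of_distinct x w p q 3 hxw hxp hxq hwp hwq hpq with rfl | rfl | rfl | rfl
  · rw [h.angle_apex hxp.symm hxq.symm hpq]; simp [faceAngle]
  · rw [h.angle_base hxw hwp.symm hwq.symm hxp hxq hpq]; simp [faceAngle, hxw]
  · rw [angle_comm, h.angle_lateral hxp hpq.symm hxq]; simp [faceAngle, hxp, hwp]
  · rw [h.angle_lateral hxq hpq hxp]; simp [faceAngle, hxq, hwq]

lemma arccos_lt (h : IsRightPyramid b a l) : Real.arccos (a / (2 * l)) < Real.pi / 2 := by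
  have ha := h.base_pos
  have hl := h.lateral_pos
  rw [Real.arccos_lt_pi_div_two]
  positivity

lemma arccos_ne (h : IsRightPyramid b a l) (hla : l ≠ a) :
    Real.arccos (a / (2 * l)) ≠ Real.pi / 3 := fun he => by
  have ha := h.base_pos
  have hl := h.lateral_pos
  have h2 := he ▸ Real.arccos_lt_pi_div_two.2 (show 0 < a / (2 * l) by positivity)
  have h1 : a / (2 * l) ≤ 1 := by
    by_contra! h3
    rw [Real.arccos_eq_zero.2 h3.le] at he
    linarith [Real.pi_pos]
  have h4 := Real.cos_arccos (by linarith [show 0 < a / (2 * l) by positivity]) h1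
  rw [he, Real.cos_pi_div_three] at h4
  field_simp at h4
  exact hla h4

lemma sq_lt (h : IsRightPyramid b a l) : a ^ 2 < 3 * l ^ 2 := by
  have hinner : ∀ p q : Fin 4, p ≠ 3 → q ≠ 3 → p ≠ q →
      inner ℝ (b p - b 3) (b q - b 3) = l ^ 2 - a ^ 2 / 2 := by
    intro p q hp hq hpq
    have := norm_sub_sq_real (b p - b 3) (b q - b 3)
    rw [sub_sub_sub_cancel_right, ← dist_eq_norm, ← dist_eq_norm, ← dist_eq_norm,
      dist_comm _ (b 3), dist_comm _ (b 3), h.base p q hp hq hpq, h.lateral p hp,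
      h.lateral q hq] at this
    linarith
  have hnorm : ∀ p : Fin 4, p ≠ 3 → ‖b p - b 3‖ = l := fun p hp => by
    rw [← dist_eq_norm, dist_comm, h.lateral p hp]
  have hne : (b 0 - b 3) + (b 1 - b 3) + (b 2 - b 3) ≠ 0 := fun he => by
    have := congrArg (b.coord 3).linear he
    simp only [map_add, map_zero, ← vsub_eq_sub, AffineMap.linearMap_vsub,
      b.coord_apply_eq, b.coord_apply_ne (show (3 : Fin 4) ≠ 0 by decide),
      b.coord_apply_ne (show (3 : Fin 4) ≠ 1 by decide),
      b.coord_apply_ne (show (3 : Fin 4) ≠ 2 by decide)] at this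
    norm_num at this
  have hpos := norm_pos_iff.2 hne
  have : ‖(b 0 - b 3) + (b 1 - b 3) + (b 2 - b 3)‖ ^ 2 = 9 * l ^ 2 - 3 * a ^ 2 := by
    rw [norm_add_sq_real, norm_add_sq_real, inner_add_left, hnorm 0 (by decide),
      hnorm 1 (by decide), hnorm 2 (by decide), hinner 0 1 (by decide) (by decide) (by decide),
      hinner 0 2 (by decide) (by decide) (by decide),
      hinner 1 2 (by decide) (by decide) (by decide)]
    ring
  have := pow_pos hpos 2
  linarith

lemma lt_arccos (h : IsRightPyramid b a l) : Real.pi / 6 < Real.arccos (a / (2 * l)) := by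
  have ha := h.base_pos
  have hl := h.lateral_pos
  have hpi := Real.pi_pos
  have hlt : a / (2 * l) < Real.cos (Real.pi / 6) := by
    rw [Real.cos_pi_div_six, div_lt_iff₀ (by positivity)]
    have : a < √3 * l := by
      refine lt_of_pow_lt_pow_left₀ 2 (by positivity) ?_
      rw [mul_pow, Real.sq_sqrt (by norm_num)]
      exact h.sq_lt
    linarith
  have h1 : Real.pi / 6 = Real.arccos (Real.cos (Real.pi / 6)) :=
    (Real.arccos_cos (by positivity) (by linarith)).symm
  rw [h1]
  refine Real.strictAntiOn_arccos ⟨?_, ?_⟩ ⟨Real.neg_one_le_cos _, Real.cos_le_one _⟩ hlt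
  · linarith [show 0 < a / (2 * l) by positivity]
  · exact hlt.le.trans (Real.cos_le_one _)

lemma positiveCurvature (h : IsRightPyramid b a l) : PositiveCurvature b := by
  intro x p q r hxp hxq hxr hpq hpr hqr
  have h1 := h.lt_arccos
  have h2 := h.arccos_lt
  have hpi := Real.pi_pos
  rw [← h.angle_eq_faceAngle x r p q hxr hxp hxq hpr.symm hqr.symm hpq,
    ← h.angle_eq_faceAngle x p q r hxp hxq hxr hpq hpr hqr,
    ← h.angle_eq_faceAngle x q r p hxq hxr hxp hqr hpq.symm hpr.symm]
  rcases mem_of_distinct x p q r 3 hxp hxq hxr hpq hpr hqr with rfl | rfl | rfl | rfl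
  · simp only [faceAngle, if_true]; linarith
  · simp only [faceAngle, if_true, if_neg hxp, if_neg hpr.symm, if_neg hpq.symm]; linarith
  · simp only [faceAngle, if_true, if_neg hxq, if_neg hpq, if_neg hqr.symm]; linarith
  · simp only [faceAngle, if_true, if_neg hxr, if_neg hpr, if_neg hqr]; linarith

lemma not_geodesicPolygon (h : IsRightPyramid b a l) (hla : l ≠ a) {n : ℕ} [NeZero n]
    {P : ZMod n → EuclideanSpace ℝ (Fin 3)} {f : ZMod n → Fin 4} :
    ¬ GeodesicPolygon b n P f := by
  intro H
  have S := H.arcSystem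
  obtain ⟨g, hg⟩ := S.exists_parity
  obtain ⟨G, hG⟩ := S.exists_colour hg
  have hsum := S.sum_cornerSign hG (faceAngle (Real.arccos (a / (2 * l))))
  rw [H.sum_eq_zero h.angle_eq_faceAngle] at hsum
  have hG0 : (G : ℝ) ≠ 0 := by
    intro h0
    obtain ⟨c1, c2, -⟩ := S.corner_ne 0
    have := hG 0 _ c1 c2
    rw [Int.cast_eq_zero.1 h0, zero_mul] at this
    rcases cornerSign_eq_one_or _ _ _ c1 c2 (H.ne_succ 0) with k | k <;> rw [k] at this <;>
      exact absurd this (by decide)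
  have hempty : ∀ x, (ArcSystem.arcs f x x).card = 0 := by
    intro x
    rw [Finset.card_eq_zero, Finset.eq_empty_iff_forall_notMem]
    intro e he
    rw [ArcSystem.mem_arcs] at he
    exact (S.corner_ne e).2.1 (he.2.trans he.1.symm)
  obtain ⟨x, w, hxw, hodd⟩ := S.exists_odd
  refine Nat.not_even_iff_odd.2 hodd (even_of_signed_sum h.lt_arccos h.arccos_lt
    (h.arccos_ne hla) (fun x w => (ArcSystem.arcs f x w).card) g hg hempty
    (faceAngle (Real.arccos (a / (2 * l)))) (fun w _ => if_pos rfl) ?_ ?_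
    ((mul_eq_zero.1 hsum.symm).resolve_left hG0) x w hxw)
  · intro y hy; simp [faceAngle, hy]
  · intro y v hy hv _; simp [faceAngle, hy, hv]

end IsRightPyramid
end TetraGeodesic

/-- A right triangular pyramid that is not a regular tetrahedron admits no
simple closed geodesic on its surface. -/
theorem right_pyramid_no_geodesic
    (A B C V : EuclideanSpace ℝ (Fin 3)) (a b : ℝ) (ha : 0 < a)
    (hAB : dist A B = a) (hBC : dist B C = a) (hCA : dist C A = a)
    (hVA : dist V A = b) (hVB : dist V B = b) (hVC : dist V C = b)
    (hba : b ≠ a)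
    (hindep : AffineIndependent ℝ ![A, B, C, V]) :
    ¬ ∃ γ : ℝ → EuclideanSpace ℝ (Fin 3),
      IsSimpleClosedGeodesicIn (frontier (convexHull ℝ {A, B, C, V})) γ := by
  rintro ⟨γ, hγ⟩
  let e : AffineBasis (Fin 4) ℝ (EuclideanSpace ℝ (Fin 3)) := ⟨![A, B, C, V], hindep,
    hindep.affineSpan_eq_top_iff_card_eq_finrank_add_one.2 (by simp)⟩
  have hrange : Set.range e = {A, B, C, V} := by
    have : (e : Fin 4 → EuclideanSpace ℝ (Fin 3)) = ![A, B, C, V] := rfl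
    rw [this]
    simp only [Matrix.range_cons, Matrix.range_empty, Set.union_empty, Set.singleton_union]
  have hp : TetraGeodesic.IsRightPyramid e a b := by
    refine ⟨?_, ?_⟩
    · intro x y hx hy hxy
      fin_cases x <;> fin_cases y <;> first
        | exact absurd rfl hx
        | exact absurd rfl hy
        | exact absurd rfl hxy
        | assumption
        | (rw [dist_comm]; assumption)
    · intro x hx
      fin_cases x <;> first
        | exact absurd rfl hx
        | assumption
  rw [← hrange] at hγ
  obtain ⟨n, hn, P, f, H⟩ := hγ.locallyShortest.exists_geodesicPolygon hp.positiveCurvature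
  exact hp.not_geodesicPolygon hba H
end
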